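/- Let n ≥ 3 and let C ⊆ S²_B(so(n)) be a closed convex O(n)-invariant set such that: every nonzero R ∈ C has positive scalar curvature; every R ∈ C has positive semidefinite Ricci tensor; C contains every positive semidefinite curvature operator of rank 1; and R² + R^# ∈ T_R C for every R ∈ C. Let b ∈ (0, (√(2n(n−2)+4) − 2)/(n(n−2))] and let a be defined by 2a = 2b + (n−2)b². Then the set ℓ_{a,b}(C) is invariant under the ordinary differential equation dR/dt = R² + R^#, i.e. S² + S^# ∈ T_S(ℓ_{a,b}(C)) for every S ∈ ℓ_{a,b}(C); moreover, S² + S^# lies in the interior of T_S(ℓ_{a,b}(C)) for every nonzero S ∈ ℓ_{a,b}(C). -/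

import Mathlib

/-!
Common setup: we identify ⋀²ℝⁿ with the Lie algebra `so n` of real skew-symmetric
`n × n` matrices, sending `eᵢ ∧ eⱼ` to the rotation by `π/2` in the plane spanned by
`eᵢ, eⱼ`; the inner product on `so n` is `⟪A, B⟫ = -(1/2)·tr (A * B)`, and under this
identification `v ∧ w` corresponds to the skew-symmetric matrix `v wᵀ - w vᵀ`, while
the wedge `A ∧ B` of two endomorphisms of `ℝⁿ` acts on a skew matrix `M` by
`M ↦ (1/2)(A M Bᵀ + B M Aᵀ)` (the unique linear extension of
`v∧w ↦ (1/2)(Av ∧ Bw + Bv ∧ Aw)`).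
-/

noncomputable section

namespace BW

open Matrix

abbrev Mat (n : ℕ) := Matrix (Fin n) (Fin n) ℝ

/-- `so n`: the space of real skew-symmetric `n × n` matrices (≅ ⋀²ℝⁿ). -/
def so (n : ℕ) : Submodule ℝ (Mat n) where
  carrier := {A | Aᵀ = -A}
  add_mem' := by
    intro A B hA hB
    simp only [Set.mem_setOf_eq] at *
    rw [Matrix.transpose_add, hA, hB, neg_add]
  zero_mem' := by simp
  smul_mem' := by
    intro c A hA
    simp only [Set.mem_setOf_eq] at *
    rw [Matrix.transpose_smul, hA, smul_neg]

variable {n : ℕ}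

lemma mem_so_iff {A : Mat n} : A ∈ so n ↔ Aᵀ = -A := Iff.rfl

/-- The inner product `⟨A,B⟩ = -(1/2)·tr(AB)` on `so n`. -/
def ip (A B : so n) : ℝ := -(1/2) * Matrix.trace ((A : Mat n) * (B : Mat n))

/-- `ip` as a linear map in the second variable. -/
def ipL (A : so n) : so n →ₗ[ℝ] ℝ where
  toFun B := ip A B
  map_add' B C := by
    simp only [ip, Submodule.coe_add, Matrix.mul_add, Matrix.trace_add]; ring
  map_smul' c B := by
    simp only [ip, SetLike.val_smul, Matrix.mul_smul, Matrix.trace_smul, smul_eq_mul,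
      RingHom.id_apply]; ring

/-- The Lie bracket (matrix commutator) on `so n`. -/
def brk (A B : so n) : so n :=
  ⟨(A : Mat n) * (B : Mat n) - (B : Mat n) * (A : Mat n), by
    have hA : (A : Mat n)ᵀ = -(A : Mat n) := A.2
    have hB : (B : Mat n)ᵀ = -(B : Mat n) := B.2
    rw [mem_so_iff, Matrix.transpose_sub, Matrix.transpose_mul, Matrix.transpose_mul, hA, hB]
    noncomm_ring⟩

/-- Auxiliary linear map underlying `A ∧ B`. -/
def wedgeAux (A B : Mat n) : Mat n →ₗ[ℝ] Mat n where
  toFun M := (1/2 : ℝ) • (A * M * Bᵀ + B * M * Aᵀ)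
  map_add' M N := by
    simp only [mul_add, add_mul, smul_add]
    module
  map_smul' c M := by
    simp only [mul_smul_comm, smul_mul_assoc, RingHom.id_apply]
    module

lemma wedgeAux_mem (A B : Mat n) : ∀ M ∈ so n, wedgeAux A B M ∈ so n := by
  intro M hM
  rw [mem_so_iff] at hM ⊢
  show ((1/2 : ℝ) • (A * M * Bᵀ + B * M * Aᵀ))ᵀ = -((1/2 : ℝ) • (A * M * Bᵀ + B * M * Aᵀ))
  rw [Matrix.transpose_smul, Matrix.transpose_add, Matrix.transpose_mul, Matrix.transpose_mul,
    Matrix.transpose_mul, Matrix.transpose_mul, Matrix.transpose_transpose,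
    Matrix.transpose_transpose, hM]
  simp only [Matrix.neg_mul, Matrix.mul_neg, Matrix.mul_assoc, smul_neg, neg_add, smul_add]
  abel

/-- The wedge `A ∧ B` of two endomorphisms of ℝⁿ, as an endomorphism of `so n ≅ ⋀²ℝⁿ`:
the unique linear map with `(A ∧ B)(v ∧ w) = (1/2)(Av ∧ Bw + Bv ∧ Aw)`. -/
def wedge (A B : Mat n) : Module.End ℝ (so n) :=
  (wedgeAux A B).restrict (p := so n) (q := so n) (wedgeAux_mem A B)

/-- The index set of pairs `i < j`. -/
def pairs (n : ℕ) : Finset (Fin n × Fin n) := Finset.univ.filter fun p => p.1 < p.2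

/-- The standard basis vector `eᵢ` of ℝⁿ. -/
def evec (i : Fin n) : Fin n → ℝ := fun k => if k = i then 1 else 0

/-- `v ∧ w`, as an element of `so n ≅ ⋀²ℝⁿ`. -/
def vwedge (v w : Fin n → ℝ) : so n :=
  ⟨Matrix.of fun i j => v i * w j - w i * v j, by
    rw [mem_so_iff]
    ext i j
    simp only [Matrix.transpose_apply, Matrix.of_apply, Matrix.neg_apply]
    ring⟩

/-- The orthonormal basis vector `eᵢ ∧ eⱼ` of `so n ≅ ⋀²ℝⁿ`. -/
def bvec (i j : Fin n) : so n := vwedge (evec i) (evec j)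

/-- Hamilton's sharp product `R # S`: the self-adjoint endomorphism of `so n` determined by
`⟨(R#S)h, h⟩ = (1/2)·Σ_{α,β} ⟨[R(b_α), S(b_β)], h⟩·⟨[b_α, b_β], h⟩`,
where `(b_α)` is the orthonormal basis `(eᵢ ∧ eⱼ)_{i<j}` of `so n`. -/
def sharp (R S : Module.End ℝ (so n)) : Module.End ℝ (so n) :=
  (1/4 : ℝ) • ∑ p ∈ pairs n, ∑ q ∈ pairs n,
    ((ipL (brk (R (bvec p.1 p.2)) (S (bvec q.1 q.2)))).smulRight
        (brk (bvec p.1 p.2) (bvec q.1 q.2))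
      + (ipL (brk (bvec p.1 p.2) (bvec q.1 q.2))).smulRight
        (brk (R (bvec p.1 p.2)) (S (bvec q.1 q.2))))

/-- The right-hand side `R² + R^#` of Hamilton's ODE. -/
def Qode (R : Module.End ℝ (so n)) : Module.End ℝ (so n) := R * R + sharp R R

/-- The coordinates `R_{ijkl} = ⟨R(eᵢ∧eⱼ), e_k∧e_l⟩` of an endomorphism of `so n`. -/
def Rcoord (R : Module.End ℝ (so n)) (i j k l : Fin n) : ℝ := ip (R (bvec i j)) (bvec k l)

/-- Self-adjointness with respect to the inner product `ip`. -/
def selfAdjEnd (R : Module.End ℝ (so n)) : Prop := ∀ X Y : so n, ip (R X) Y = ip X (R Y)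

/-- A curvature operator: a self-adjoint endomorphism of `so n ≅ ⋀²ℝⁿ` satisfying the
first Bianchi identity.  (`isCurvOp` carves out `S²_B(so n)`.) -/
def isCurvOp (R : Module.End ℝ (so n)) : Prop :=
  selfAdjEnd R ∧
    ∀ i j k l : Fin n, Rcoord R i j k l + Rcoord R j k i l + Rcoord R k i j l = 0

/-- The Ricci tensor `Ric_{ij} = Σ_k R_{ikjk}` of `R`. -/
def RicM (R : Module.End ℝ (so n)) : Mat n := Matrix.of fun i j => ∑ k, Rcoord R i k j k

/-- `λ̄ = tr(Ric)/n`. -/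
def lamb (R : Module.End ℝ (so n)) : ℝ := Matrix.trace (RicM R) / (n : ℝ)

/-- The traceless Ricci tensor `Ric₀ = Ric - (tr Ric / n)·id`. -/
def Ric0 (R : Module.End ℝ (so n)) : Mat n := RicM R - lamb R • (1 : Mat n)

/-- `σ = tr(Ric₀²)/n`. -/
def sigmaR (R : Module.End ℝ (so n)) : ℝ := Matrix.trace (Ric0 R * Ric0 R) / (n : ℝ)

/-- `R_I = (λ̄/(n-1))·(id ∧ id)`, the projection of `R` onto `⟨I⟩`. -/
def RI (R : Module.End ℝ (so n)) : Module.End ℝ (so n) :=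
  (lamb R / ((n : ℝ) - 1)) • wedge (1 : Mat n) (1 : Mat n)

/-- `R_{Ric₀} = (2/(n-2))·(Ric₀ ∧ id)`, the projection of `R` onto `⟨Ric₀⟩`. -/
def RRic0 (R : Module.End ℝ (so n)) : Module.End ℝ (so n) :=
  (2 / ((n : ℝ) - 2)) • wedge (Ric0 R) (1 : Mat n)

/-- The linear map `ℓ_{a,b}(R) = R + 2(n-1)a·R_I + (n-2)b·R_{Ric₀}`. -/
def lab (a b : ℝ) (R : Module.End ℝ (so n)) : Module.End ℝ (so n) :=
  R + (2 * ((n : ℝ) - 1) * a) • RI R + (((n : ℝ) - 2) * b) • RRic0 R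

/-- Positive semidefiniteness of the quadratic form of an endomorphism of `so n`. -/
def posSemidefEnd (R : Module.End ℝ (so n)) : Prop := ∀ X : so n, 0 ≤ ip (R X) X

/-- Positive definiteness of the quadratic form of an endomorphism of `so n`. -/
def posDefEnd (R : Module.End ℝ (so n)) : Prop := ∀ X : so n, X ≠ 0 → 0 < ip (R X) X

/-- `R` is 2-nonnegative: the sum of its two smallest eigenvalues is nonnegative;
equivalently (Ky Fan), `q_R(X) + q_R(Y) ≥ 0` for all orthonormal pairs `X, Y`. -/
def twoNonneg (R : Module.End ℝ (so n)) : Prop :=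
  ∀ X Y : so n, ip X X = 1 → ip Y Y = 1 → ip X Y = 0 → 0 ≤ ip (R X) X + ip (R Y) Y

/-- The (Frobenius) norm of an endomorphism of `so n`, computed in the orthonormal
basis `(eᵢ ∧ eⱼ)_{i<j}`. -/
def endNorm (R : Module.End ℝ (so n)) : ℝ :=
  Real.sqrt (∑ p ∈ pairs n, ip (R (bvec p.1 p.2)) (R (bvec p.1 p.2)))

/-- The tangent cone `T_R C`: the closure of `{t·(S - R) : S ∈ C, t ≥ 0}`. -/
def tangCone (C : Set (Module.End ℝ (so n))) (R : Module.End ℝ (so n)) :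
    Set (Module.End ℝ (so n)) :=
  {X | ∀ ε > 0, ∃ S ∈ C, ∃ t : ℝ, 0 ≤ t ∧ endNorm (X - t • (S - R)) < ε}

/-- `C` is a closed subset of the space of endomorphisms of `so n`. -/
def isClosedSet (C : Set (Module.End ℝ (so n))) : Prop :=
  ∀ X, (∀ ε > 0, ∃ Y ∈ C, endNorm (X - Y) < ε) → X ∈ C

/-- The interior of `C` relative to the subspace `S²_B(so n)` of curvature operators. -/
def interiorCurv (C : Set (Module.End ℝ (so n))) : Set (Module.End ℝ (so n)) :=
  {X | isCurvOp X ∧ ∃ ε > 0, ∀ Y, isCurvOp Y → endNorm (Y - X) < ε → Y ∈ C}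

/-- Auxiliary linear map `M ↦ g M gᵀ` on matrices. -/
def conjAux (g : Mat n) : Mat n →ₗ[ℝ] Mat n where
  toFun M := g * M * gᵀ
  map_add' M N := by simp only [mul_add, add_mul]
  map_smul' c M := by simp only [mul_smul_comm, smul_mul_assoc, RingHom.id_apply]

/-- `⋀²g` : the action `M ↦ g M gᵀ` of `g` on `so n ≅ ⋀²ℝⁿ` (for `g` orthogonal this is
the second exterior power of `g`). -/
def conjSo (g : Mat n) : Module.End ℝ (so n) :=
  (conjAux g).restrict (p := so n) (q := so n) (fun M hM => by
    rw [mem_so_iff] at hM ⊢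
    show (g * M * gᵀ)ᵀ = -(g * M * gᵀ)
    rw [Matrix.transpose_mul, Matrix.transpose_mul, Matrix.transpose_transpose, hM]
    simp only [Matrix.neg_mul, Matrix.mul_neg, Matrix.mul_assoc])

/-- The action `g · R = (⋀²g) ∘ R ∘ (⋀²g)⁻¹` of an orthogonal matrix `g`
(whose inverse is `gᵀ`) on endomorphisms of `so n`. -/
def onAct (g : Mat n) (R : Module.End ℝ (so n)) : Module.End ℝ (so n) :=
  conjSo g * R * conjSo gᵀ

/-- Two sets are at Hausdorff distance at most `ε` from each other. -/
def hdClose (A B : Set (Module.End ℝ (so n))) (ε : ℝ) : Prop :=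
  (∀ X ∈ A, ∃ Y ∈ B, endNorm (X - Y) ≤ ε) ∧ ∀ Y ∈ B, ∃ X ∈ A, endNorm (X - Y) ≤ ε

/-- The truncation `C ∩ {‖R‖ ≤ 1}`. -/
def truncSet (C : Set (Module.End ℝ (so n))) : Set (Module.End ℝ (so n)) :=
  {R ∈ C | endNorm R ≤ 1}

/-! ### Coordinates -/

lemma bvec_apply (p q i j : Fin n) : (bvec p q : Mat n) i j =
    (if i = p then 1 else 0) * (if j = q then 1 else 0)
      - (if i = q then 1 else 0) * (if j = p then 1 else 0) := rfl

lemma so_skew (X : so n) (i j : Fin n) : (X : Mat n) i j = -(X : Mat n) j i := by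
  have h : (X : Mat n)ᵀ = -(X : Mat n) := X.2
  exact congrFun (congrFun h j) i

lemma bvec_swap (p q : Fin n) : bvec q p = -bvec p q := by
  apply Subtype.ext
  ext i j
  simp only [bvec_apply, NegMemClass.coe_neg, Matrix.neg_apply]
  ring

lemma bvec_self (p : Fin n) : bvec p p = 0 := by
  apply Subtype.ext
  ext i j
  simp [bvec_apply]

lemma ip_eq_sum (X Y : so n) :
    ip X Y = (1 / 2) * ∑ i, ∑ j, (X : Mat n) i j * (Y : Mat n) i j := by
  simp only [ip, Matrix.trace, Matrix.diag, Matrix.mul_apply]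
  rw [neg_mul, ← mul_neg, ← Finset.sum_neg_distrib]
  congr 1
  refine Finset.sum_congr rfl fun i _ => ?_
  rw [← Finset.sum_neg_distrib]
  refine Finset.sum_congr rfl fun j _ => ?_
  rw [so_skew Y j i]
  ring

lemma ip_comm (X Y : so n) : ip X Y = ip Y X := by
  simp only [ip_eq_sum, mul_comm]

lemma ip_bvec (X : so n) (k l : Fin n) : ip X (bvec k l) = (X : Mat n) k l := by
  rw [ip_eq_sum]
  simp only [bvec_apply, mul_sub, Finset.sum_sub_distrib, mul_ite, mul_one, mul_zero,
    Finset.sum_ite_eq', Finset.mem_univ, if_true]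
  rw [so_skew X l k]
  ring

lemma Rcoord_eq (R : Module.End ℝ (so n)) (i j k l : Fin n) :
    Rcoord R i j k l = (R (bvec i j) : Mat n) k l := ip_bvec _ _ _

lemma Rcoord_swap_left (R : Module.End ℝ (so n)) (i j k l : Fin n) :
    Rcoord R j i k l = -Rcoord R i j k l := by
  simp [Rcoord_eq, bvec_swap i j]

lemma Rcoord_swap_right (R : Module.End ℝ (so n)) (i j k l : Fin n) :
    Rcoord R i j l k = -Rcoord R i j k l := by
  rw [Rcoord_eq, Rcoord_eq, so_skew]

lemma so_eq_sum (X : so n) :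
    X = (1 / 2 : ℝ) • ∑ i, ∑ j, (X : Mat n) i j • bvec i j := by
  apply Subtype.ext
  ext k l
  simp only [Submodule.coe_smul, Submodule.coe_sum, Matrix.smul_apply, Matrix.sum_apply,
    smul_eq_mul, bvec_apply, mul_sub, Finset.sum_sub_distrib, mul_ite, mul_one, mul_zero,
    Finset.sum_ite_eq, Finset.mem_univ, if_true, Finset.sum_ite_irrel, Finset.sum_const_zero]
  rw [so_skew X l k]
  ring

lemma End_apply (R : Module.End ℝ (so n)) (X : so n) (k l : Fin n) :
    (R X : Mat n) k l = (1 / 2) * ∑ i, ∑ j, (X : Mat n) i j * Rcoord R i j k l := by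
  conv_lhs => rw [so_eq_sum X]
  simp only [map_smul, map_sum, Submodule.coe_smul, Submodule.coe_sum, Matrix.smul_apply,
    Matrix.sum_apply, smul_eq_mul, Rcoord_eq]

lemma End_ext {R S : Module.End ℝ (so n)} (h : ∀ i j k l, Rcoord R i j k l = Rcoord S i j k l) :
    R = S := by
  refine LinearMap.ext fun X => Subtype.ext ?_
  ext k l
  simp only [End_apply, h]

lemma sum_swap_pairs {ι : Type*} [Fintype ι] (f : ι → ι → ι → ι → ℝ) :
    ∑ i, ∑ j, ∑ k, ∑ l, f i j k l = ∑ i, ∑ j, ∑ k, ∑ l, f k l i j := by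
  have h (g : ι → ι → ι → ι → ℝ) : ∑ i, ∑ j, ∑ k, ∑ l, g i j k l =
      ∑ x : ι × ι, ∑ y : ι × ι, g x.1 x.2 y.1 y.2 := by
    simp only [Fintype.sum_prod_type]
  rw [h, h, Finset.sum_comm]

lemma selfAdjEnd_iff {R : Module.End ℝ (so n)} :
    selfAdjEnd R ↔ ∀ i j k l, Rcoord R i j k l = Rcoord R k l i j := by
  constructor
  · intro h i j k l
    rw [Rcoord, h, ip_comm, Rcoord]
  · intro h X Y
    simp only [ip_eq_sum, End_apply, Finset.mul_sum, Finset.sum_mul]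
    rw [sum_swap_pairs]
    refine Finset.sum_congr rfl fun i _ => Finset.sum_congr rfl fun j _ =>
      Finset.sum_congr rfl fun k _ => Finset.sum_congr rfl fun l _ => ?_
    rw [h i j k l]
    ring

@[simp] lemma Rcoord_zero (i j k l : Fin n) : Rcoord (0 : Module.End ℝ (so n)) i j k l = 0 := by
  simp [Rcoord_eq]

lemma Rcoord_add (R S : Module.End ℝ (so n)) (i j k l : Fin n) :
    Rcoord (R + S) i j k l = Rcoord R i j k l + Rcoord S i j k l := by
  simp [Rcoord_eq]

lemma Rcoord_sub (R S : Module.End ℝ (so n)) (i j k l : Fin n) :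
    Rcoord (R - S) i j k l = Rcoord R i j k l - Rcoord S i j k l := by
  simp [Rcoord_eq]

lemma Rcoord_smul (t : ℝ) (R : Module.End ℝ (so n)) (i j k l : Fin n) :
    Rcoord (t • R) i j k l = t * Rcoord R i j k l := by
  simp [Rcoord_eq]

lemma Rcoord_sum {ι : Type*} (s : Finset ι) (R : ι → Module.End ℝ (so n)) (i j k l : Fin n) :
    Rcoord (∑ x ∈ s, R x) i j k l = ∑ x ∈ s, Rcoord (R x) i j k l := by
  simp [Rcoord_eq, Matrix.sum_apply]

lemma Rcoord_mul (R S : Module.End ℝ (so n)) (i j k l : Fin n) :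
    Rcoord (R * S) i j k l = (1 / 2) * ∑ p, ∑ q, Rcoord S i j p q * Rcoord R p q k l := by
  rw [Rcoord_eq, Module.End.mul_apply, End_apply]
  simp only [← Rcoord_eq]

lemma Rcoord_wedge (A B : Mat n) (i j k l : Fin n) :
    Rcoord (wedge A B) i j k l =
      (1 / 2) * (A k i * B l j - A k j * B l i + B k i * A l j - B k j * A l i) := by
  rw [Rcoord_eq]
  have : ((wedge A B (bvec i j) : so n) : Mat n)
      = (1 / 2 : ℝ) • (A * (bvec i j : Mat n) * Bᵀ + B * (bvec i j : Mat n) * Aᵀ) := rfl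
  rw [this]
  simp only [Matrix.smul_apply, Matrix.add_apply, Matrix.mul_apply, bvec_apply, mul_sub,
    Finset.sum_sub_distrib, mul_ite, mul_one, mul_zero, Finset.sum_ite_irrel,
    Finset.sum_const_zero, Finset.sum_ite_eq', Finset.mem_univ, if_true, sub_mul, ite_mul,
    zero_mul, Matrix.transpose_apply, smul_eq_mul]
  ring

lemma wedge_comm (A B : Mat n) : wedge A B = wedge B A :=
  End_ext fun i j k l => by simp only [Rcoord_wedge]; ring

lemma wedge_add_left (A B D : Mat n) : wedge (A + B) D = wedge A D + wedge B D :=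
  End_ext fun i j k l => by simp only [Rcoord_wedge, Rcoord_add, Matrix.add_apply]; ring

lemma wedge_sub_left (A B D : Mat n) : wedge (A - B) D = wedge A D - wedge B D :=
  End_ext fun i j k l => by simp only [Rcoord_wedge, Rcoord_sub, Matrix.sub_apply]; ring

lemma wedge_smul_left (t : ℝ) (A D : Mat n) : wedge (t • A) D = t • wedge A D :=
  End_ext fun i j k l => by
    simp only [Rcoord_wedge, Rcoord_smul, Matrix.smul_apply, smul_eq_mul]; ring

lemma wedge_add_right (A B D : Mat n) : wedge D (A + B) = wedge D A + wedge D B := by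
  simp only [wedge_comm D, wedge_add_left]

lemma wedge_smul_right (t : ℝ) (A D : Mat n) : wedge D (t • A) = t • wedge D A := by
  simp only [wedge_comm D, wedge_smul_left]

lemma wedge_sum_left {ι : Type*} (s : Finset ι) (A : ι → Mat n) (D : Mat n) :
    wedge (∑ x ∈ s, A x) D = ∑ x ∈ s, wedge (A x) D :=
  End_ext fun i j k l => by
    simp only [Rcoord_wedge, Rcoord_sum, Matrix.sum_apply, Finset.sum_mul, Finset.mul_sum,
      ← Finset.sum_sub_distrib, ← Finset.sum_add_distrib]

lemma wedge_sum_right {ι : Type*} (s : Finset ι) (A : ι → Mat n) (D : Mat n) :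
    wedge D (∑ x ∈ s, A x) = ∑ x ∈ s, wedge D (A x) := by
  simp only [wedge_comm D, wedge_sum_left]

lemma isCurvOp_iff {R : Module.End ℝ (so n)} : isCurvOp R ↔
    (∀ i j k l, Rcoord R i j k l = Rcoord R k l i j) ∧
      ∀ i j k l, Rcoord R i j k l + Rcoord R j k i l + Rcoord R k i j l = 0 := by
  rw [isCurvOp, selfAdjEnd_iff]

lemma isCurvOp_wedge {A B : Mat n} (hA : Aᵀ = A) (hB : Bᵀ = B) : isCurvOp (wedge A B) := by
  have hA' : ∀ i j, A i j = A j i := fun i j => congrFun (congrFun hA.symm i) j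
  have hB' : ∀ i j, B i j = B j i := fun i j => congrFun (congrFun hB.symm i) j
  rw [isCurvOp_iff]
  refine ⟨fun i j k l => ?_, fun i j k l => ?_⟩
  · simp only [Rcoord_wedge]
    rw [hA' k i, hA' l j, hA' k j, hA' l i, hB' k i, hB' l j, hB' k j, hB' l i]
    ring
  · simp only [Rcoord_wedge]
    rw [hA' k i, hA' k j, hA' j i, hB' k i, hB' k j, hB' j i]
    ring

lemma isCurvOp_add {R S : Module.End ℝ (so n)} (hR : isCurvOp R) (hS : isCurvOp S) :
    isCurvOp (R + S) := by
  rw [isCurvOp_iff] at *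
  refine ⟨fun i j k l => ?_, fun i j k l => ?_⟩
  · rw [Rcoord_add, Rcoord_add, hR.1, hS.1]
  · simp only [Rcoord_add]
    linarith [hR.2 i j k l, hS.2 i j k l]

lemma isCurvOp_smul (t : ℝ) {R : Module.End ℝ (so n)} (hR : isCurvOp R) :
    isCurvOp (t • R) := by
  rw [isCurvOp_iff] at *
  refine ⟨fun i j k l => ?_, fun i j k l => ?_⟩
  · rw [Rcoord_smul, Rcoord_smul, hR.1]
  · simp only [Rcoord_smul]
    linear_combination t * hR.2 i j k l

lemma isCurvOp_sub {R S : Module.End ℝ (so n)} (hR : isCurvOp R) (hS : isCurvOp S) :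
    isCurvOp (R - S) := by
  have h := isCurvOp_add hR (isCurvOp_smul (-1) hS)
  rwa [show R + (-1 : ℝ) • S = R - S by module] at h

/-! ### The sharp product in coordinates -/

lemma brk_apply (X Y : so n) (i j : Fin n) :
    (brk X Y : Mat n) i j = ∑ m, ((X : Mat n) i m * (Y : Mat n) m j
      - (Y : Mat n) i m * (X : Mat n) m j) := by
  simp [brk, Matrix.sub_apply, Matrix.mul_apply, Finset.sum_sub_distrib]

lemma brk_neg_left (X Y : so n) : brk (-X) Y = -brk X Y := by
  apply Subtype.ext
  simp only [brk, NegMemClass.coe_neg]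
  noncomm_ring

lemma brk_neg_right (X Y : so n) : brk X (-Y) = -brk X Y := by
  apply Subtype.ext
  simp only [brk, NegMemClass.coe_neg]
  noncomm_ring

lemma brk_zero_left (Y : so n) : brk 0 Y = 0 := by
  apply Subtype.ext
  simp [brk]

lemma brk_zero_right (Y : so n) : brk Y 0 = 0 := by
  apply Subtype.ext
  simp [brk]

lemma sum_pairs (f : Fin n → Fin n → ℝ) (hf : ∀ i j, f j i = f i j) (h0 : ∀ i, f i i = 0) :
    ∑ p ∈ pairs n, f p.1 p.2 = (1 / 2) * ∑ i, ∑ j, f i j := by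
  have h1 : ∑ p ∈ pairs n, f p.1 p.2 = ∑ i, ∑ j, if i < j then f i j else 0 := by
    rw [pairs, Finset.sum_filter, Fintype.sum_prod_type]
  have h2 : ∑ i, ∑ j, f i j = ∑ i, ∑ j, ((if i < j then f i j else 0)
      + (if j < i then f j i else 0)) := by
    refine Finset.sum_congr rfl fun i _ => Finset.sum_congr rfl fun j _ => ?_
    rcases lt_trichotomy i j with h | h | h
    · simp [h, h.not_gt]
    · simp [h, h0]
    · simp [h, h.not_gt, hf]
  rw [h1, h2]
  simp only [Finset.sum_add_distrib]
  rw [Finset.sum_comm (f := fun i j => if j < i then f j i else 0)]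
  ring

lemma brk_bvec (p q r s k l : Fin n) : (brk (bvec p q) (bvec r s) : Mat n) k l =
    (1 : Mat n) q r * (bvec p s : Mat n) k l - (1 : Mat n) q s * (bvec p r : Mat n) k l
      - (1 : Mat n) p r * (bvec q s : Mat n) k l + (1 : Mat n) p s * (bvec q r : Mat n) k l := by
  have h (x y : Fin n) : ∑ m, (1 : Mat n) m x * (1 : Mat n) m y = (1 : Mat n) x y := by
    simp [Matrix.one_apply, eq_comm]
  have hb (x y i j : Fin n) : (bvec x y : Mat n) i j =
      (1 : Mat n) i x * (1 : Mat n) j y - (1 : Mat n) i y * (1 : Mat n) j x := by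
    simp only [bvec_apply, Matrix.one_apply]
  simp only [brk_apply, hb, ← h q r, ← h q s, ← h p r, ← h p s, Finset.sum_mul,
    ← Finset.sum_sub_distrib, ← Finset.sum_add_distrib]
  refine Finset.sum_congr rfl fun m _ => ?_
  ring

/-- The coordinates of `(1/2) Σ_{α,β} [R b_α, S b_β] ⊗ [b_α, b_β]`, up to a factor of two. -/
def sharpCoord (R S : Module.End ℝ (so n)) (i j k l : Fin n) : ℝ :=
  ∑ q, ∑ m, (Rcoord R k q i m * Rcoord S q l m j - Rcoord S q l i m * Rcoord R k q m j
    - Rcoord R l q i m * Rcoord S q k m j + Rcoord S q k i m * Rcoord R l q m j)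

lemma sum_brk_mul_brk (R S : Module.End ℝ (so n)) (i j k l : Fin n) :
    ∑ p ∈ pairs n, ∑ q ∈ pairs n,
      (brk (R (bvec p.1 p.2)) (S (bvec q.1 q.2)) : Mat n) i j *
        (brk (bvec p.1 p.2) (bvec q.1 q.2) : Mat n) k l = sharpCoord R S i j k l := by
  have hq (p : Fin n × Fin n) : ∑ q ∈ pairs n,
      (brk (R (bvec p.1 p.2)) (S (bvec q.1 q.2)) : Mat n) i j *
        (brk (bvec p.1 p.2) (bvec q.1 q.2) : Mat n) k l = (1 / 2) * ∑ r, ∑ s,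
      (brk (R (bvec p.1 p.2)) (S (bvec r s)) : Mat n) i j *
        (brk (bvec p.1 p.2) (bvec r s) : Mat n) k l := by
    refine sum_pairs (fun r s => (brk (R (bvec p.1 p.2)) (S (bvec r s)) : Mat n) i j *
        (brk (bvec p.1 p.2) (bvec r s) : Mat n) k l) (fun r s => ?_) (fun r => ?_)
    · simp [bvec_swap r s, brk_neg_right]
    · simp [bvec_self, brk_zero_right]
  simp only [hq]
  rw [sum_pairs (fun p q => 1 / 2 * ∑ r, ∑ s, (brk (R (bvec p q)) (S (bvec r s)) : Mat n) i j *
        (brk (bvec p q) (bvec r s) : Mat n) k l)]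
  rotate_left
  · intro p q
    simp [bvec_swap p q, brk_neg_left]
  · intro p
    simp [bvec_self, brk_zero_left]
  set Φ : Fin n → Fin n → Fin n → Fin n → ℝ := fun p q r s =>
    (brk (R (bvec p q)) (S (bvec r s)) : Mat n) i j with hΦ
  have hΦ1 (p q r s : Fin n) : Φ q p r s = -Φ p q r s := by
    simp [hΦ, bvec_swap p q, brk_neg_left]
  have hΦ2 (p q r s : Fin n) : Φ p q s r = -Φ p q r s := by
    simp [hΦ, bvec_swap r s, brk_neg_right]
  have h1 : ∑ p, ∑ q, ∑ r, ∑ s, Φ p q r s * ((1 : Mat n) q r * (bvec p s : Mat n) k l)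
      = sharpCoord R S i j k l := by
    simp only [Matrix.one_apply, ite_mul, one_mul, zero_mul, mul_ite, mul_zero,
      Finset.sum_ite_irrel, Finset.sum_const_zero, Finset.sum_ite_eq, Finset.mem_univ, if_true]
    rw [Finset.sum_comm]
    simp only [bvec_apply, mul_sub, Finset.sum_sub_distrib, mul_ite, mul_one, mul_zero,
      Finset.sum_ite_irrel, Finset.sum_const_zero, Finset.sum_ite_eq, Finset.mem_univ, if_true]
    rw [← Finset.sum_sub_distrib, sharpCoord]
    refine Finset.sum_congr rfl fun q _ => ?_
    simp only [hΦ, brk_apply, ← Rcoord_eq, ← Finset.sum_sub_distrib]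
    refine Finset.sum_congr rfl fun m _ => ?_
    ring
  have h2 : ∑ p, ∑ q, ∑ r, ∑ s, Φ p q r s * ((1 : Mat n) q s * (bvec p r : Mat n) k l)
      = -sharpCoord R S i j k l := by
    rw [← h1]
    simp only [← Finset.sum_neg_distrib]
    refine Finset.sum_congr rfl fun p _ => Finset.sum_congr rfl fun q _ => ?_
    rw [Finset.sum_comm]
    refine Finset.sum_congr rfl fun r _ => Finset.sum_congr rfl fun s _ => ?_
    rw [hΦ2]
    ring
  have h3 : ∑ p, ∑ q, ∑ r, ∑ s, Φ p q r s * ((1 : Mat n) p r * (bvec q s : Mat n) k l)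
      = -sharpCoord R S i j k l := by
    rw [← h1, Finset.sum_comm]
    simp only [← Finset.sum_neg_distrib]
    refine Finset.sum_congr rfl fun p _ => Finset.sum_congr rfl fun q _ =>
      Finset.sum_congr rfl fun r _ => Finset.sum_congr rfl fun s _ => ?_
    rw [hΦ1]
    ring
  have h4 : ∑ p, ∑ q, ∑ r, ∑ s, Φ p q r s * ((1 : Mat n) p s * (bvec q r : Mat n) k l)
      = sharpCoord R S i j k l := by
    rw [← neg_neg (sharpCoord R S i j k l), ← h2, Finset.sum_comm]
    simp only [← Finset.sum_neg_distrib]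
    refine Finset.sum_congr rfl fun p _ => Finset.sum_congr rfl fun q _ =>
      Finset.sum_congr rfl fun r _ => Finset.sum_congr rfl fun s _ => ?_
    rw [hΦ1]
    ring
  change 1 / 2 * ∑ p, ∑ q, 1 / 2 * ∑ r, ∑ s,
    Φ p q r s * (brk (bvec p q) (bvec r s) : Mat n) k l = _
  clear_value Φ
  simp only [brk_bvec, mul_add, mul_sub, Finset.sum_add_distrib, Finset.sum_sub_distrib,
    ← Finset.mul_sum, h1, h2, h3, h4]
  ring

lemma Rcoord_sharp (R S : Module.End ℝ (so n)) (i j k l : Fin n) :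
    Rcoord (sharp R S) i j k l =
      (1 / 4) * (sharpCoord R S i j k l + sharpCoord R S k l i j) := by
  rw [← sum_brk_mul_brk, ← sum_brk_mul_brk, Rcoord_eq, ← Finset.sum_add_distrib]
  simp only [← Finset.sum_add_distrib]
  have h : (sharp R S (bvec i j)) = (1/4 : ℝ) • ∑ p ∈ pairs n, ∑ q ∈ pairs n,
    ((ip (brk (R (bvec p.1 p.2)) (S (bvec q.1 q.2))) (bvec i j)) •
        (brk (bvec p.1 p.2) (bvec q.1 q.2))
      + (ip (brk (bvec p.1 p.2) (bvec q.1 q.2)) (bvec i j)) •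
        (brk (R (bvec p.1 p.2)) (S (bvec q.1 q.2)))) := by
    simp [sharp, LinearMap.sum_apply, ipL]
  rw [h]
  simp only [ip_bvec, Submodule.coe_smul, Submodule.coe_sum, Submodule.coe_add, Matrix.smul_apply,
    Matrix.add_apply, Matrix.sum_apply, smul_eq_mul]
  congr 1
  refine Finset.sum_congr rfl fun p _ => Finset.sum_congr rfl fun q _ => ?_
  ring

/-! ### The bilinearisation of `R² + R^#` at `A ∧ id` -/

/-- The contraction `Σ_{k,l} R_{ikjl} A_{kl}` of a curvature operator with a matrix. -/
def contr (R : Module.End ℝ (so n)) (A : Mat n) : Mat n :=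
  Matrix.of fun i j => ∑ k, ∑ l, Rcoord R i k j l * A k l

/-- The polarisation of `R ↦ R² + R^#`. -/
def Qpol (R S : Module.End ℝ (so n)) : Module.End ℝ (so n) :=
  R * S + S * R + sharp R S + sharp S R

lemma sharpCoord_add_add (R S : Module.End ℝ (so n)) (i j k l : Fin n) :
    sharpCoord (R + S) (R + S) i j k l = sharpCoord R R i j k l + sharpCoord R S i j k l
      + sharpCoord S R i j k l + sharpCoord S S i j k l := by
  simp only [sharpCoord, Rcoord_add, ← Finset.sum_add_distrib]
  refine Finset.sum_congr rfl fun q _ => Finset.sum_congr rfl fun m _ => ?_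
  ring

lemma sharp_add_add (R S : Module.End ℝ (so n)) :
    sharp (R + S) (R + S) = sharp R R + sharp R S + sharp S R + sharp S S :=
  End_ext fun i j k l => by
    simp only [Rcoord_add, Rcoord_sharp, sharpCoord_add_add]
    ring

lemma Qode_add (R S : Module.End ℝ (so n)) : Qode (R + S) = Qode R + Qpol R S + Qode S := by
  simp only [Qode, Qpol, sharp_add_add, add_mul, mul_add]
  abel

lemma Qpol_self (R : Module.End ℝ (so n)) : Qpol R R = (2 : ℝ) • Qode R := by
  simp only [Qode, Qpol]
  module

lemma sharpCoord_comm (R S : Module.End ℝ (so n)) (i j k l : Fin n) :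
    sharpCoord S R i j k l = sharpCoord R S i j k l := by
  simp only [sharpCoord]
  refine Finset.sum_congr rfl fun q _ => Finset.sum_congr rfl fun m _ => ?_
  simp only [Rcoord_swap_left S q k, Rcoord_swap_left S q l, Rcoord_swap_left R q k,
    Rcoord_swap_left R q l]
  ring

lemma sharp_comm (R S : Module.End ℝ (so n)) : sharp S R = sharp R S :=
  End_ext fun i j k l => by simp only [Rcoord_sharp, sharpCoord_comm]

lemma sum_Rcoord_mul_wedge_one {R : Module.End ℝ (so n)} (hR : isCurvOp R) {A : Mat n}
    (hA : Aᵀ = A) (k i l j : Fin n) :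
    ∑ q, ∑ m, Rcoord R k q i m * Rcoord (wedge A 1) q l m j =
      (1 / 2) * ((1 : Mat n) j l * contr R A k i + A j l * RicM R k i
        - ∑ m, Rcoord R k j i m * A m l - ∑ m, Rcoord R i l k m * A m j) := by
  have hA' : ∀ i j, A i j = A j i := fun i j => congrFun (congrFun hA.symm i) j
  have hs := (isCurvOp_iff.1 hR).1
  have h1 : ∑ q, ∑ m, Rcoord R k q i m * ((1 : Mat n) j l * A q m)
      = (1 : Mat n) j l * contr R A k i := by
    simp only [contr, Matrix.of_apply, Finset.mul_sum]
    refine Finset.sum_congr rfl fun q _ => Finset.sum_congr rfl fun m _ => ?_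
    ring
  have h2 : ∑ q, ∑ m, Rcoord R k q i m * ((1 : Mat n) m q * A j l) = A j l * RicM R k i := by
    simp only [RicM, Matrix.of_apply, Matrix.one_apply, ite_mul, mul_ite, one_mul, zero_mul,
      mul_zero, Finset.sum_ite_eq', Finset.mem_univ, if_true, Finset.mul_sum]
    refine Finset.sum_congr rfl fun q _ => ?_
    ring
  have h3 : ∑ q, ∑ m, Rcoord R k q i m * ((1 : Mat n) j q * A m l)
      = ∑ m, Rcoord R k j i m * A m l := by
    simp only [Matrix.one_apply, ite_mul, mul_ite, one_mul, zero_mul,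
      mul_zero, Finset.sum_ite_irrel, Finset.sum_const_zero, Finset.sum_ite_eq, Finset.mem_univ,
      if_true]
  have h4 : ∑ q, ∑ m, Rcoord R k q i m * ((1 : Mat n) m l * A q j)
      = ∑ m, Rcoord R i l k m * A m j := by
    simp only [Matrix.one_apply, ite_mul, mul_ite, one_mul, zero_mul,
      mul_zero, Finset.sum_ite_eq', Finset.mem_univ, if_true]
    refine Finset.sum_congr rfl fun q _ => ?_
    rw [hs k q i l]
  rw [← h1, ← h2, ← h3, ← h4]
  simp only [← Finset.sum_add_distrib, ← Finset.sum_sub_distrib, Finset.mul_sum]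
  refine Finset.sum_congr rfl fun q _ => Finset.sum_congr rfl fun m _ => ?_
  rw [Rcoord_wedge, hA' m q, hA' j q]
  ring

lemma sharpCoord_wedge_one (R : Module.End ℝ (so n)) (A : Mat n) (i j k l : Fin n) :
    sharpCoord R (wedge A 1) i j k l =
      ∑ q, ∑ m, Rcoord R k q i m * Rcoord (wedge A 1) q l m j
      - ∑ q, ∑ m, Rcoord R k q j m * Rcoord (wedge A 1) q l m i
      - ∑ q, ∑ m, Rcoord R l q i m * Rcoord (wedge A 1) q k m j
      + ∑ q, ∑ m, Rcoord R l q j m * Rcoord (wedge A 1) q k m i := by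
  simp only [sharpCoord, ← Finset.sum_add_distrib, ← Finset.sum_sub_distrib]
  refine Finset.sum_congr rfl fun q _ => Finset.sum_congr rfl fun m _ => ?_
  rw [Rcoord_swap_right (wedge A 1) q l m i, Rcoord_swap_right (wedge A 1) q k m i,
    Rcoord_swap_right R k q j m, Rcoord_swap_right R l q j m]
  ring

lemma Rcoord_mul_wedge_one {R : Module.End ℝ (so n)} (hR : isCurvOp R) (A : Mat n)
    (i j k l : Fin n) :
    Rcoord (R * wedge A 1) i j k l =
      (1 / 2) * (∑ m, Rcoord R k l i m * A m j - ∑ m, Rcoord R k l j m * A m i) := by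
  have hs := (isCurvOp_iff.1 hR).1
  have key (x y : Fin n) : ∑ p, ∑ q, Rcoord R k l p q * ((1 : Mat n) p x * A q y) =
      ∑ m, Rcoord R k l x m * A m y := by
    simp only [Matrix.one_apply, ite_mul, mul_ite, one_mul, zero_mul,
      mul_zero, Finset.sum_ite_irrel, Finset.sum_const_zero, Finset.sum_ite_eq', Finset.mem_univ,
      if_true]
  have key' (x y : Fin n) : ∑ p, ∑ q, Rcoord R k l p q * ((1 : Mat n) q x * A p y) =
      -∑ m, Rcoord R k l x m * A m y := by
    rw [← key, Finset.sum_comm]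
    simp only [← Finset.sum_neg_distrib]
    refine Finset.sum_congr rfl fun p _ => Finset.sum_congr rfl fun q _ => ?_
    rw [Rcoord_swap_right R k l p q]
    ring
  have h : ∑ m, Rcoord R k l i m * A m j - ∑ m, Rcoord R k l j m * A m i =
      (1 / 2) * (∑ p, ∑ q, Rcoord R k l p q * ((1 : Mat n) p i * A q j)
        - ∑ p, ∑ q, Rcoord R k l p q * ((1 : Mat n) p j * A q i)
        - ∑ p, ∑ q, Rcoord R k l p q * ((1 : Mat n) q i * A p j)
        + ∑ p, ∑ q, Rcoord R k l p q * ((1 : Mat n) q j * A p i)) := by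
    rw [key, key, key', key']
    ring
  rw [h, Rcoord_mul]
  simp only [← Finset.sum_add_distrib, ← Finset.sum_sub_distrib, Finset.mul_sum]
  refine Finset.sum_congr rfl fun p _ => Finset.sum_congr rfl fun q _ => ?_
  rw [Rcoord_wedge, hs p q k l]
  ring

lemma transpose_RicM {R : Module.End ℝ (so n)} (hR : isCurvOp R) : (RicM R)ᵀ = RicM R := by
  ext i j
  simp only [Matrix.transpose_apply, RicM, Matrix.of_apply]
  refine Finset.sum_congr rfl fun q _ => ?_
  rw [(isCurvOp_iff.1 hR).1 j q i q]

lemma transpose_contr {R : Module.End ℝ (so n)} (hR : isCurvOp R) {A : Mat n} (hA : Aᵀ = A) :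
    (contr R A)ᵀ = contr R A := by
  ext i j
  simp only [Matrix.transpose_apply, contr, Matrix.of_apply]
  rw [Finset.sum_comm]
  refine Finset.sum_congr rfl fun p _ => Finset.sum_congr rfl fun q _ => ?_
  rw [(isCurvOp_iff.1 hR).1 j q i p, ← congrFun (congrFun hA p) q, Matrix.transpose_apply]

lemma Qpol_wedge_one {R : Module.End ℝ (so n)} (hR : isCurvOp R) {A : Mat n} (hA : Aᵀ = A) :
    Qpol R (wedge A 1) = wedge (RicM R) A + wedge (contr R A) 1 := by
  have hA' : ∀ i j, A i j = A j i := fun i j => congrFun (congrFun hA.symm i) j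
  have hRic : ∀ i j, RicM R i j = RicM R j i := fun i j =>
    congrFun (congrFun (transpose_RicM hR).symm i) j
  have hC : ∀ i j, contr R A i j = contr R A j i := fun i j =>
    congrFun (congrFun (transpose_contr hR hA).symm i) j
  have h1 : ∀ i j, (1 : Mat n) i j = (1 : Mat n) j i := fun i j => by
    simp only [Matrix.one_apply, eq_comm]
  obtain ⟨hs, hbi⟩ := isCurvOp_iff.1 hR
  have hL := (isCurvOp_iff.1 (isCurvOp_wedge hA (Matrix.transpose_one (n := Fin n) (α := ℝ)))).1
  have hLR (i j k l : Fin n) : Rcoord (wedge A 1 * R) i j k l = Rcoord (R * wedge A 1) k l i j := by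
    rw [Rcoord_mul, Rcoord_mul]
    congr 1
    refine Finset.sum_congr rfl fun p _ => Finset.sum_congr rfl fun q _ => ?_
    rw [hs i j p q, hL p q k l, mul_comm]
  set s : Fin n → Fin n → Fin n → Fin n → ℝ := fun a b c x => ∑ m, Rcoord R a b c m * A m x
    with hsdef
  have hsw (a b c x : Fin n) : s b a c x = -s a b c x := by
    simp only [hsdef, Rcoord_swap_left R a b, neg_mul, Finset.sum_neg_distrib]
  have hB (a b c x : Fin n) : s a b c x + s b c a x + s c a b x = 0 := by
    simp only [hsdef, ← Finset.sum_add_distrib]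
    refine Finset.sum_eq_zero fun m _ => ?_
    have e1 := hbi a b m c
    rw [hs b m a c, hs m a b c] at e1
    have e4 := Rcoord_swap_right R a b c m
    have e5 := Rcoord_swap_right R b c a m
    have e6 := Rcoord_swap_left R a c b m
    linear_combination A m x * (-e1 + e4 + e5 + e6)
  have hsf (a b c x : Fin n) : ∑ m, Rcoord R a b c m * A m x = s a b c x := rfl
  refine End_ext fun i j k l => ?_
  simp only [Qpol, sharp_comm R (wedge A 1), Rcoord_add, hLR, Rcoord_mul_wedge_one hR,
    Rcoord_sharp, sharpCoord_wedge_one, sum_Rcoord_mul_wedge_one hR hA, hsf]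
  simp only [Rcoord_wedge]
  clear_value s
  rw [hA' j l, hA' i l, hA' j k, hA' i k, h1 j l, h1 i l, h1 j k, h1 i k, hC i k, hC i l, hC j k,
    hC j l, hRic i k, hRic i l, hRic j k, hRic j l]
  linear_combination (1 / 2) * (hB k l i j - hB k l j i + hB i j k l - hB i j l k
    + hsw j l i k + hsw j l k i - hsw j k i l - hsw i l k j)

/-! ### Ricci tensors -/

lemma RicM_add (R S : Module.End ℝ (so n)) : RicM (R + S) = RicM R + RicM S := by
  ext i j
  simp [RicM, Rcoord_add, Finset.sum_add_distrib]

lemma RicM_smul (t : ℝ) (R : Module.End ℝ (so n)) : RicM (t • R) = t • RicM R := by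
  ext i j
  simp [RicM, Rcoord_smul, Finset.mul_sum]

lemma RicM_wedge {A B : Mat n} (hA : Aᵀ = A) (hB : Bᵀ = B) : RicM (wedge A B) =
    (1 / 2 : ℝ) • (Matrix.trace B • A + Matrix.trace A • B - A * B - B * A) := by
  have hA' : ∀ i j, A i j = A j i := fun i j => congrFun (congrFun hA.symm i) j
  have hB' : ∀ i j, B i j = B j i := fun i j => congrFun (congrFun hB.symm i) j
  ext i j
  simp only [RicM, Matrix.of_apply, Matrix.smul_apply, Matrix.sub_apply, Matrix.add_apply,
    Matrix.trace, Matrix.diag, Matrix.mul_apply, smul_eq_mul, Finset.sum_mul, Finset.mul_sum,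
    ← Finset.sum_add_distrib, ← Finset.sum_sub_distrib]
  refine Finset.sum_congr rfl fun k _ => ?_
  rw [Rcoord_wedge, hA' i k, hA' i j, hB' i k, hB' i j, hA' j k, hB' j k]
  ring

lemma contr_add_right (R : Module.End ℝ (so n)) (A B : Mat n) :
    contr R (A + B) = contr R A + contr R B := by
  ext i j
  simp [contr, mul_add, Finset.sum_add_distrib]

lemma contr_smul_right (R : Module.End ℝ (so n)) (t : ℝ) (A : Mat n) :
    contr R (t • A) = t • contr R A := by
  ext i j
  simp only [contr, Matrix.of_apply, Matrix.smul_apply, smul_eq_mul, Finset.mul_sum]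
  refine Finset.sum_congr rfl fun k _ => Finset.sum_congr rfl fun l _ => ?_
  ring

lemma contr_one (R : Module.End ℝ (so n)) : contr R 1 = RicM R := by
  ext i j
  simp [contr, RicM, Matrix.one_apply]

lemma contr_wedge_one {A : Mat n} (hA : Aᵀ = A) : contr (wedge A 1) A =
    (1 / 2 : ℝ) • (Matrix.trace A • A - (2 : ℝ) • (A * A) + Matrix.trace (A * A) • (1 : Mat n)) := by
  have hA' : ∀ i j, A i j = A j i := fun i j => congrFun (congrFun hA.symm i) j
  ext i j
  have h1 : ∑ k, ∑ l, (1 : Mat n) l k * A j i * A k l = Matrix.trace A * A i j := by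
    simp [Matrix.one_apply, Matrix.trace, Finset.mul_sum, hA' i j, mul_comm]
  have h2 : ∑ k, ∑ l, (1 : Mat n) l i * A j k * A k l = (A * A) i j := by
    simp [Matrix.one_apply, Matrix.mul_apply, hA' i, hA' j, mul_comm]
  have h3 : ∑ k, ∑ l, (1 : Mat n) j k * A l i * A k l = (A * A) i j := by
    simp [Matrix.one_apply, Matrix.mul_apply, hA' i, hA' j]
  have h4 : ∑ k, ∑ l, (1 : Mat n) j i * A l k * A k l
      = Matrix.trace (A * A) * (1 : Mat n) i j := by
    simp only [Matrix.trace, Matrix.diag, Matrix.mul_apply, Finset.sum_mul]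
    refine Finset.sum_congr rfl fun k _ => Finset.sum_congr rfl fun l _ => ?_
    simp only [Matrix.one_apply, eq_comm]
    ring
  simp only [Matrix.smul_apply, Matrix.sub_apply, Matrix.add_apply, smul_eq_mul]
  rw [← h1, ← h4, two_mul]
  nth_rewrite 1 [← h2]
  rw [← h3]
  simp only [contr, Matrix.of_apply, Rcoord_wedge, ← Finset.sum_add_distrib,
    ← Finset.sum_sub_distrib, Finset.mul_sum]
  refine Finset.sum_congr rfl fun k _ => Finset.sum_congr rfl fun l _ => ?_
  ring

lemma trace_contr (R : Module.End ℝ (so n)) (A : Mat n) :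
    Matrix.trace (contr R A) = Matrix.trace (RicM R * Aᵀ) := by
  simp only [Matrix.trace, Matrix.diag, Matrix.mul_apply, contr, RicM, Matrix.of_apply,
    Matrix.transpose_apply, Finset.sum_mul]
  rw [Finset.sum_comm]
  refine Finset.sum_congr rfl fun k _ => ?_
  rw [Finset.sum_comm]
  refine Finset.sum_congr rfl fun l _ => Finset.sum_congr rfl fun i _ => ?_
  rw [Rcoord_swap_left, Rcoord_swap_right, neg_neg]

lemma RicM_Qode {R : Module.End ℝ (so n)} (hR : isCurvOp R) :
    RicM (Qode R) = contr R (RicM R) := by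
  obtain ⟨hs, hbi⟩ := isCurvOp_iff.1 hR
  have hRic : ∀ i j, RicM R i j = RicM R j i := fun i j =>
    congrFun (congrFun (transpose_RicM hR).symm i) j
  have h1 (i j : Fin n) : ∑ k, ∑ q, ∑ m, Rcoord R j q i m * Rcoord R q k m k
      = contr R (RicM R) i j := by
    rw [Finset.sum_comm, contr, Matrix.of_apply]
    conv_rhs => rw [Finset.sum_comm]
    refine Finset.sum_congr rfl fun q _ => ?_
    rw [Finset.sum_comm]
    refine Finset.sum_congr rfl fun m _ => ?_
    rw [hRic m q, RicM, Matrix.of_apply, Finset.mul_sum]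
    refine Finset.sum_congr rfl fun k _ => ?_
    rw [hs j q i m]
  have h2 (i j : Fin n) : ∑ k, sharpCoord R R i k j k = 2 * contr R (RicM R) i j
      - 2 * ∑ k, ∑ q, ∑ m, Rcoord R q k i m * Rcoord R j q m k := by
    simp only [← h1, sharpCoord, Finset.mul_sum, ← Finset.sum_sub_distrib]
    refine Finset.sum_congr rfl fun k _ => Finset.sum_congr rfl fun q _ =>
      Finset.sum_congr rfl fun m _ => ?_
    simp only [Rcoord_swap_left R j q, Rcoord_swap_left R q k]
    ring
  have h3 (i j : Fin n) : ∑ k, ∑ q, ∑ m, Rcoord R q k i m * Rcoord R j q m k =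
      (1 / 2) * ∑ k, ∑ p, ∑ q, Rcoord R i k p q * Rcoord R j k p q := by
    have e1 : ∑ k, ∑ q, ∑ m, Rcoord R q k i m * Rcoord R j q m k =
        ∑ k, ∑ q, ∑ m, Rcoord R k q i m * Rcoord R j k m q := Finset.sum_comm
    have e2 : ∑ k, ∑ p, ∑ q, Rcoord R i k p q * Rcoord R j k p q =
        ∑ k, ∑ q, ∑ m, Rcoord R i m q k * Rcoord R j m q k := by
      rw [Finset.sum_comm' (t' := Finset.univ) (s' := fun _ => Finset.univ) (by simp)]
      conv_rhs => rw [Finset.sum_comm]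
      refine Finset.sum_congr rfl fun p _ => ?_
      rw [Finset.sum_comm]
    have e3 : 2 * ∑ k, ∑ q, ∑ m, Rcoord R q k i m * Rcoord R j q m k =
        ∑ k, ∑ q, ∑ m, Rcoord R i m q k * Rcoord R j m q k := by
      rw [two_mul]
      nth_rewrite 2 [e1]
      simp only [← Finset.sum_add_distrib]
      refine Finset.sum_congr rfl fun k _ => Finset.sum_congr rfl fun q _ =>
        Finset.sum_congr rfl fun m _ => ?_
      have b1 := hbi j q k m
      have b2 := hs q k j m
      have b3 := Rcoord_swap_left R j k q m
      have b4 := Rcoord_swap_right R j q m k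
      have b5 := Rcoord_swap_right R j k m q
      rw [Rcoord_swap_left R q k i m, hs q k i m]
      linear_combination Rcoord R i m q k * (-b1 + b2 + b3 + b4 - b5)
    rw [e2, ← e3]
    ring
  ext i j
  have h4 : ∑ k, Rcoord (R * R) i k j k =
      (1 / 2) * ∑ k, ∑ p, ∑ q, Rcoord R i k p q * Rcoord R j k p q := by
    rw [Finset.mul_sum]
    refine Finset.sum_congr rfl fun k _ => ?_
    rw [Rcoord_mul]
    congr 1
    refine Finset.sum_congr rfl fun p _ => Finset.sum_congr rfl fun q _ => ?_
    rw [hs p q j k]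
  have h5 : ∑ k, ∑ p, ∑ q, Rcoord R j k p q * Rcoord R i k p q =
      ∑ k, ∑ p, ∑ q, Rcoord R i k p q * Rcoord R j k p q := by
    simp only [mul_comm]
  have h6 : contr R (RicM R) j i = contr R (RicM R) i j :=
    congrFun (congrFun (transpose_contr hR (transpose_RicM hR)) i) j
  simp only [RicM, Qode, Matrix.of_apply, Rcoord_add, Rcoord_sharp, Finset.sum_add_distrib,
    ← Finset.mul_sum, h4, h2, h3, h5]
  change _ = contr R (RicM R) i j
  change _ + 1 / 4 * ((2 * contr R (RicM R) i j - _) + (2 * contr R (RicM R) j i - _)) = _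
  rw [h6]
  ring

/-! ### The pull-back of the ODE under `ℓ_{a,b}` -/

lemma trace_RicM_Qode {R : Module.End ℝ (so n)} (hR : isCurvOp R) :
    Matrix.trace (RicM (Qode R)) = Matrix.trace (RicM R * RicM R) := by
  rw [RicM_Qode hR, trace_contr, transpose_RicM hR]

lemma RicM_sub (R S : Module.End ℝ (so n)) : RicM (R - S) = RicM R - RicM S := by
  ext i j
  simp [RicM, Rcoord_sub]

lemma lab_eq (hn : 3 ≤ n) (a b : ℝ) (R : Module.End ℝ (so n)) :
    lab a b R = R + wedge ((2 * (a - b) * lamb R) • (1 : Mat n) + (2 * b) • RicM R) 1 := by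
  have h1 : (n : ℝ) - 1 ≠ 0 := by
    have : (3 : ℝ) ≤ n := by exact_mod_cast hn
    linarith
  have h2 : (n : ℝ) - 2 ≠ 0 := by
    have : (3 : ℝ) ≤ n := by exact_mod_cast hn
    linarith
  simp only [lab, RI, RRic0, Ric0, wedge_add_left, wedge_sub_left, wedge_smul_left]
  match_scalars <;> field_simp
  ring

/-- The pulled-back correction term `ℓ_{a,b}⁻¹((ℓ_{a,b} R)² + (ℓ_{a,b} R)^#) - R² - R^#`
when `2 a = 2 b + (n - 2) b²`. -/
def Dab (a b : ℝ) (R : Module.End ℝ (so n)) : Module.End ℝ (so n) :=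
  (2 * a) • wedge (RicM R) (RicM R) + (2 * b ^ 2) • wedge (Ric0 R * Ric0 R) 1
    + (Matrix.trace (Ric0 R * Ric0 R) * (b ^ 2 * (2 - 4 * b - n * (n - 2) * b ^ 2))
        / (n + 2 * n * (n - 1) * a)) • wedge (1 : Mat n) 1

lemma Ric0_mul_self (R : Module.End ℝ (so n)) : Ric0 R * Ric0 R =
    RicM R * RicM R - (2 * lamb R) • RicM R + (lamb R ^ 2) • (1 : Mat n) := by
  simp only [Ric0, sub_mul, mul_sub, Matrix.smul_mul, Matrix.mul_smul, Matrix.one_mul,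
    Matrix.mul_one]
  module

lemma Qode_lab (hn : 3 ≤ n) {a b : ℝ} (ha : 2 * a = 2 * b + ((n : ℝ) - 2) * b ^ 2)
    (ha0 : 1 + 2 * ((n : ℝ) - 1) * a ≠ 0) {R : Module.End ℝ (so n)} (hR : isCurvOp R) :
    Qode (lab a b R) = lab a b (Qode R + Dab a b R) := by
  have hn3 : (3 : ℝ) ≤ n := by exact_mod_cast hn
  have hn0 : (n : ℝ) ≠ 0 := by linarith
  have hd : (n : ℝ) + 2 * n * (n - 1) * a ≠ 0 := by
    rw [show (n : ℝ) + 2 * n * (n - 1) * a = n * (1 + 2 * (n - 1) * a) by ring]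
    exact mul_ne_zero hn0 ha0
  have hT : (1 : Mat n)ᵀ = 1 := Matrix.transpose_one
  have hP := transpose_RicM hR
  have hPP : (RicM R * RicM R)ᵀ = RicM R * RicM R := by rw [Matrix.transpose_mul, hP]
  have htr1 : Matrix.trace (1 : Mat n) = n := by simp
  have htrP : Matrix.trace (RicM R) = n * lamb R := by rw [lamb]; field_simp
  have hRicQ := RicM_Qode hR
  have htrQ := trace_RicM_Qode hR
  set P := RicM R with hPdef
  set lam := lamb R with hlam
  set τ := Matrix.trace (P * P) with hτ
  have htr0 : Matrix.trace (Ric0 R * Ric0 R) = τ - n * lam ^ 2 := by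
    rw [Ric0_mul_self, Matrix.trace_add, Matrix.trace_sub, Matrix.trace_smul, Matrix.trace_smul,
      ← hPdef, ← hlam, ← hτ, htrP, htr1]
    simp only [smul_eq_mul]
    ring
  set c := Matrix.trace (Ric0 R * Ric0 R) * (b ^ 2 * (2 - 4 * b - n * (n - 2) * b ^ 2))
        / (n + 2 * n * (n - 1) * a) with hc
  have hD : Dab a b R = (2 * a) • wedge P P + (2 * b ^ 2) • wedge (P * P) 1
      - (4 * b ^ 2 * lam) • wedge P 1 + (2 * b ^ 2 * lam ^ 2 + c) • wedge (1 : Mat n) 1 := by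
    rw [Dab, ← hc, Ric0_mul_self, ← hPdef, ← hlam]
    simp only [wedge_add_left, wedge_sub_left, wedge_smul_left]
    module
  have hRicD : RicM (Dab a b R) = (2 * a * n * lam) • P - (2 * a) • (P * P)
      + (b ^ 2) • ((n - 2 : ℝ) • (P * P) + τ • (1 : Mat n))
      - (2 * b ^ 2 * lam) • ((n - 2 : ℝ) • P + (n * lam) • (1 : Mat n))
      + ((2 * b ^ 2 * lam ^ 2 + c) * (n - 1)) • (1 : Mat n) := by
    rw [hD]
    simp only [RicM_add, RicM_sub, RicM_smul, RicM_wedge hP hP, RicM_wedge hPP hT, RicM_wedge hP hT,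
      RicM_wedge hT hT, htr1, htrP, ← hτ, Matrix.mul_one, Matrix.one_mul]
    module
  have hlamD : lamb (Qode R + Dab a b R) = (τ + (2 * a * n ^ 2 * lam ^ 2 - 2 * a * τ
      + b ^ 2 * ((n - 2) * τ + n * τ) - 2 * b ^ 2 * lam * ((n - 2) * (n * lam) + n * lam * n)
      + (2 * b ^ 2 * lam ^ 2 + c) * (n - 1) * n)) / n := by
    rw [lamb, RicM_add, Matrix.trace_add, htrQ, hRicD]
    simp only [Matrix.trace_add, Matrix.trace_sub, Matrix.trace_smul, ← hτ, htrP, htr1,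
      smul_eq_mul]
    ring
  set α := 2 * (a - b) * lam with hα
  set A := α • (1 : Mat n) + (2 * b) • P with hA
  have hAT : Aᵀ = A := by
    rw [hA, Matrix.transpose_add, Matrix.transpose_smul, Matrix.transpose_smul, hP, hT]
  have htrA : Matrix.trace A = n * (α + 2 * b * lam) := by
    rw [hA, Matrix.trace_add, Matrix.trace_smul, Matrix.trace_smul, htr1, htrP]
    simp only [smul_eq_mul]
    ring
  have hAA : A * A = (α ^ 2) • (1 : Mat n) + (4 * b * α) • P + (4 * b ^ 2) • (P * P) := by
    simp only [hA, add_mul, mul_add, Matrix.smul_mul, Matrix.mul_smul, Matrix.one_mul,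
      Matrix.mul_one]
    module
  have htrAA : Matrix.trace (A * A) = n * α ^ 2 + 4 * b * α * (n * lam) + 4 * b ^ 2 * τ := by
    rw [hAA]
    simp only [Matrix.trace_add, Matrix.trace_smul, ← hτ, htrP, htr1, smul_eq_mul]
    ring
  have hQL : Qode (wedge A 1) = (1 / 2 : ℝ) • Qpol (wedge A 1) (wedge A 1) := by
    rw [Qpol_self]
    module
  rw [lab_eq hn, ← hPdef, ← hlam, ← hα, ← hA, Qode_add, hQL, Qpol_wedge_one hR hAT,
    Qpol_wedge_one (isCurvOp_wedge hAT hT) hAT, contr_wedge_one hAT, RicM_wedge hAT hT, htr1,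
    htrA, htrAA, hAA, lab_eq hn, hlamD, RicM_add, hRicD, hRicQ, hD, hA, contr_add_right,
    contr_smul_right, contr_smul_right, contr_one, ← hPdef]
  simp only [Matrix.mul_one, Matrix.one_mul, wedge_add_left, wedge_sub_left, wedge_smul_left,
    wedge_add_right, wedge_smul_right]
  have hcomm : wedge (1 : Mat n) P = wedge P 1 := wedge_comm _ _
  rw [hcomm, hα]
  have hcval : c = (τ - n * lam ^ 2) * (b ^ 2 * (2 - 4 * b - n * (n - 2) * b ^ 2))
      / (n + 2 * n * (n - 1) * a) := by rw [hc, htr0]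
  have haval : a = b + (n - 2) * b ^ 2 / 2 := by linarith
  have hcmul : c * (n + 2 * n * (n - 1) * a)
      = (τ - n * lam ^ 2) * (b ^ 2 * (2 - 4 * b - n * (n - 2) * b ^ 2)) := by
    rw [hcval]
    field_simp
  clear_value c τ lam
  rw [haval] at hcmul ⊢
  match_scalars
  · ring
  · field_simp
    ring
  · ring
  · ring
  · field_simp
    linear_combination (-4 : ℝ) * hcmul
  · ring

/-! ### Coordinate estimates for the norm -/

lemma endNorm_sq (R : Module.End ℝ (so n)) :
    endNorm R ^ 2 = ∑ p ∈ pairs n, (1 / 2) * ∑ k, ∑ l, Rcoord R p.1 p.2 k l ^ 2 := by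
  have h (p : Fin n × Fin n) : ip (R (bvec p.1 p.2)) (R (bvec p.1 p.2)) =
      (1 / 2) * ∑ k, ∑ l, Rcoord R p.1 p.2 k l ^ 2 := by
    rw [ip_eq_sum]
    simp only [Rcoord_eq, sq]
  rw [endNorm, Real.sq_sqrt]
  · simp only [h]
  · simp only [h]
    positivity

lemma abs_Rcoord_le_endNorm (R : Module.End ℝ (so n)) (i j k l : Fin n) :
    |Rcoord R i j k l| ≤ 2 * endNorm R := by
  have h0 : 0 ≤ endNorm R := Real.sqrt_nonneg _
  have main (i j : Fin n) (hij : i < j) : |Rcoord R i j k l| ≤ 2 * endNorm R := by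
    refine abs_le_of_sq_le_sq ?_ (by positivity)
    have h1 : (1 / 2) * ∑ k, ∑ l, Rcoord R i j k l ^ 2 ≤ endNorm R ^ 2 := by
      rw [endNorm_sq]
      exact Finset.single_le_sum
        (f := fun p : Fin n × Fin n => (1 / 2) * ∑ k, ∑ l, Rcoord R p.1 p.2 k l ^ 2)
        (fun p _ => by positivity) (a := (i, j)) (by simpa [pairs] using hij)
    have h2 : ∑ l, Rcoord R i j k l ^ 2 ≤ ∑ k, ∑ l, Rcoord R i j k l ^ 2 :=
      Finset.single_le_sum (f := fun k => ∑ l, Rcoord R i j k l ^ 2)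
        (fun p _ => by positivity) (Finset.mem_univ k)
    have h3 : Rcoord R i j k l ^ 2 ≤ ∑ l, Rcoord R i j k l ^ 2 :=
      Finset.single_le_sum (f := fun l => Rcoord R i j k l ^ 2)
        (fun p _ => by positivity) (Finset.mem_univ l)
    nlinarith [sq_nonneg (endNorm R)]
  rcases lt_trichotomy i j with h | h | h
  · exact main i j h
  · subst h
    rw [Rcoord_eq, bvec_self]
    simpa using h0
  · rw [Rcoord_swap_left R j i, abs_neg]
    exact main j i h

lemma endNorm_le {R : Module.End ℝ (so n)} {δ : ℝ} (h : ∀ i j k l, |Rcoord R i j k l| ≤ δ)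
    (hδ : 0 ≤ δ) : endNorm R ≤ (n : ℝ) ^ 2 * δ := by
  refine abs_le_of_sq_le_sq' ?_ (by positivity) |>.2
  rw [endNorm_sq]
  have hsq (i j k l : Fin n) : Rcoord R i j k l ^ 2 ≤ δ ^ 2 :=
    sq_le_sq' (abs_le.1 (h i j k l)).1 (abs_le.1 (h i j k l)).2
  calc ∑ p ∈ pairs n, (1 / 2) * ∑ k, ∑ l, Rcoord R p.1 p.2 k l ^ 2
      ≤ ∑ p : Fin n × Fin n, ∑ k, ∑ l, Rcoord R p.1 p.2 k l ^ 2 := by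
        refine (Finset.sum_le_sum fun p _ => ?_).trans
          (Finset.sum_le_sum_of_subset_of_nonneg (Finset.subset_univ _) fun p _ _ => by positivity)
        have : 0 ≤ ∑ k, ∑ l, Rcoord R p.1 p.2 k l ^ 2 := by positivity
        linarith
    _ ≤ ∑ p : Fin n × Fin n, ∑ k : Fin n, ∑ l : Fin n, δ ^ 2 := by
        exact Finset.sum_le_sum fun p _ => Finset.sum_le_sum fun k _ =>
          Finset.sum_le_sum fun l _ => hsq _ _ _ _
    _ = ((n : ℝ) ^ 2 * δ) ^ 2 := by
        simp
        ring

lemma mem_of_forall_exists_close {C : Set (Module.End ℝ (so n))} (hC : isClosedSet C)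
    {X : Module.End ℝ (so n)}
    (h : ∀ δ > 0, ∃ Y ∈ C, ∀ i j k l, |Rcoord (X - Y) i j k l| ≤ δ) : X ∈ C := by
  refine hC X fun ε hε => ?_
  obtain ⟨Y, hY, hXY⟩ := h (ε / ((n : ℝ) ^ 2 + 1)) (by positivity)
  refine ⟨Y, hY, (endNorm_le hXY (by positivity)).trans_lt ?_⟩
  rw [mul_div_assoc', div_lt_iff₀ (by positivity)]
  nlinarith

lemma exists_abs_Rcoord_le (R : Module.End ℝ (so n)) :
    ∃ M > 0, ∀ i j k l, |Rcoord R i j k l| ≤ M :=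
  ⟨2 * endNorm R + 1, by linarith [show 0 ≤ endNorm R from Real.sqrt_nonneg _],
    fun i j k l => (abs_Rcoord_le_endNorm R i j k l).trans (by linarith)⟩

lemma mem_tangCone_iff {C : Set (Module.End ℝ (so n))} {R X : Module.End ℝ (so n)} :
    X ∈ tangCone C R ↔ ∀ δ > 0, ∃ S ∈ C, ∃ t : ℝ, 0 ≤ t ∧
      ∀ i j k l, |Rcoord (X - t • (S - R)) i j k l| ≤ δ := by
  constructor
  · intro h δ hδ
    obtain ⟨S, hS, t, ht, hlt⟩ := h (δ / 2) (by positivity)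
    exact ⟨S, hS, t, ht, fun i j k l => (abs_Rcoord_le_endNorm _ i j k l).trans (by linarith)⟩
  · intro h ε hε
    obtain ⟨S, hS, t, ht, hle⟩ := h (ε / ((n : ℝ) ^ 2 + 1)) (by positivity)
    refine ⟨S, hS, t, ht, (endNorm_le hle (by positivity)).trans_lt ?_⟩
    rw [mul_div_assoc', div_lt_iff₀ (by positivity)]
    nlinarith

lemma isCurvOp_of_mem_tangCone {C : Set (Module.End ℝ (so n))} (hC : ∀ R ∈ C, isCurvOp R)
    {R X : Module.End ℝ (so n)} (hR : isCurvOp R) (hX : X ∈ tangCone C R) : isCurvOp X := by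
  rw [mem_tangCone_iff] at hX
  rw [isCurvOp_iff]
  refine ⟨fun i j k l => ?_, fun i j k l => ?_⟩
  · rw [← sub_eq_zero, ← abs_nonpos_iff]
    refine le_of_forall_pos_le_add fun ε hε => ?_
    obtain ⟨S, hS, t, -, hle⟩ := hX (ε / 2) (by positivity)
    have h1 := abs_le.1 (hle i j k l)
    have h2 := abs_le.1 (hle k l i j)
    have h3 := (isCurvOp_iff.1 (isCurvOp_smul t (isCurvOp_sub (hC S hS) hR))).1 i j k l
    rw [Rcoord_sub] at h1 h2
    rw [abs_le]
    constructor <;> linarith [h1.1, h1.2, h2.1, h2.2]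
  · rw [← abs_nonpos_iff]
    refine le_of_forall_pos_le_add fun ε hε => ?_
    obtain ⟨S, hS, t, -, hle⟩ := hX (ε / 3) (by positivity)
    have h1 := abs_le.1 (hle i j k l)
    have h2 := abs_le.1 (hle j k i l)
    have h4 := abs_le.1 (hle k i j l)
    have h3 := (isCurvOp_iff.1 (isCurvOp_smul t (isCurvOp_sub (hC S hS) hR))).2 i j k l
    rw [Rcoord_sub] at h1 h2 h4
    rw [abs_le]
    constructor <;> linarith [h1.1, h1.2, h2.1, h2.2, h4.1, h4.2]

lemma exists_abs_Rcoord_lab_le (hn : 3 ≤ n) (a b : ℝ) : ∃ M > 0,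
    ∀ (R : Module.End ℝ (so n)) (δ : ℝ), 0 ≤ δ → (∀ i j k l, |Rcoord R i j k l| ≤ δ) →
      ∀ i j k l, |Rcoord (lab a b R) i j k l| ≤ M * δ := by
  have hn0 : (0 : ℝ) < n := by
    have : 0 < n := by omega
    exact_mod_cast this
  refine ⟨1 + 2 * (|2 * (a - b)| * n + |2 * b| * n), by positivity, fun R δ hδ h i j k l => ?_⟩
  have hRic (i j : Fin n) : |RicM R i j| ≤ n * δ := by
    change |∑ q, Rcoord R i q j q| ≤ _
    refine (Finset.abs_sum_le_sum_abs _ _).trans ?_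
    refine (Finset.sum_le_sum fun q _ => h i q j q).trans_eq ?_
    simp
  have hlam : |lamb R| ≤ n * δ := by
    rw [lamb, abs_div, abs_of_pos hn0, div_le_iff₀ hn0]
    change |∑ q, RicM R q q| ≤ _
    refine (Finset.abs_sum_le_sum_abs _ _).trans ?_
    refine (Finset.sum_le_sum fun q _ => hRic q q).trans_eq ?_
    simp
    ring
  have hone (i j : Fin n) : |(1 : Mat n) i j| ≤ 1 := by
    rw [Matrix.one_apply]
    split_ifs <;> simp
  set A := (2 * (a - b) * lamb R) • (1 : Mat n) + (2 * b) • RicM R with hA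
  set m := (|2 * (a - b)| * n + |2 * b| * n) * δ with hm
  have hAm (i j : Fin n) : |A i j| ≤ m := by
    rw [hA, Matrix.add_apply, Matrix.smul_apply, Matrix.smul_apply, smul_eq_mul, smul_eq_mul]
    refine (abs_add_le _ _).trans ?_
    rw [abs_mul, abs_mul (2 * b), abs_mul (2 * (a - b))]
    calc |2 * (a - b)| * |lamb R| * |(1 : Mat n) i j| + |2 * b| * |RicM R i j|
        ≤ |2 * (a - b)| * (n * δ) * 1 + |2 * b| * (n * δ) := by
          gcongr
          · exact hone i j
          · exact hRic i j
      _ = m := by rw [hm]; ring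
  have hprod (i j k l : Fin n) : |A i j * (1 : Mat n) k l| ≤ m := by
    rw [abs_mul]
    calc |A i j| * |(1 : Mat n) k l| ≤ m * 1 := by
          exact mul_le_mul (hAm i j) (hone k l) (abs_nonneg _) ((abs_nonneg _).trans (hAm i j))
      _ = m := mul_one m
  rw [lab_eq hn, ← hA, Rcoord_add, Rcoord_wedge]
  have h0 := abs_le.1 (h i j k l)
  have h1 := abs_le.1 (hprod k i l j)
  have h2 := abs_le.1 (hprod k j l i)
  have h3 := abs_le.1 (hprod l j k i)
  have h4 := abs_le.1 (hprod l i k j)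
  rw [abs_le]
  constructor <;> nlinarith

/-! ### Directions absorbed by a convex set -/

/-- The directions `D` such that `R + t D` stays in `C` for all `R ∈ C` and `t ≥ 0`. -/
def recCone (C : Set (Module.End ℝ (so n))) : Set (Module.End ℝ (so n)) :=
  {D | ∀ R ∈ C, ∀ t : ℝ, 0 ≤ t → R + t • D ∈ C}

section recCone

variable {C : Set (Module.End ℝ (so n))}

lemma zero_mem_recCone : (0 : Module.End ℝ (so n)) ∈ recCone C := fun R hR t _ => by
  simpa using hR

lemma add_mem_recCone {D E : Module.End ℝ (so n)} (hD : D ∈ recCone C) (hE : E ∈ recCone C) :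
    D + E ∈ recCone C := fun R hR t ht => by
  rw [smul_add, ← add_assoc]
  exact hE _ (hD R hR t ht) t ht

lemma smul_mem_recCone {D : Module.End ℝ (so n)} (hD : D ∈ recCone C) {s : ℝ} (hs : 0 ≤ s) :
    s • D ∈ recCone C := fun R hR t ht => by
  rw [smul_smul]
  exact hD R hR _ (mul_nonneg ht hs)

lemma sum_mem_recCone {ι : Type*} (s : Finset ι) {D : ι → Module.End ℝ (so n)}
    (hD : ∀ i ∈ s, D i ∈ recCone C) : ∑ i ∈ s, D i ∈ recCone C := by
  classical
  induction s using Finset.induction_on with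
  | empty => simpa using zero_mem_recCone
  | insert i s hi ih =>
    rw [Finset.sum_insert hi]
    exact add_mem_recCone (hD i (Finset.mem_insert_self i s))
      (ih fun j hj => hD j (Finset.mem_insert_of_mem hj))

lemma add_mem_of_forall_smul_mem (hclosed : isClosedSet C) (hconv : Convex ℝ C)
    {R P : Module.End ℝ (so n)} (hR : R ∈ C) (hP : ∀ t : ℝ, 0 < t → t • P ∈ C) : R + P ∈ C := by
  refine mem_of_forall_exists_close hclosed fun δ hδ => ?_
  obtain ⟨M, hM, hRM⟩ := exists_abs_Rcoord_le R
  set s := min 1 (δ / M) with hs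
  have hs0 : 0 < s := by positivity
  have hs1 : s ≤ 1 := min_le_left _ _
  have hsM : s * M ≤ δ := (le_div_iff₀ hM).1 (min_le_right _ _)
  refine ⟨(1 - s) • R + s • (s⁻¹ • P), hconv hR (hP _ (inv_pos.2 hs0)) (by linarith) hs0.le
    (by ring), fun i j k l => ?_⟩
  rw [smul_smul, mul_inv_cancel₀ hs0.ne', show R + P - ((1 - s) • R + (1 : ℝ) • P) = s • R by
    module, Rcoord_smul, abs_mul, abs_of_pos hs0]
  exact (mul_le_mul_of_nonneg_left (hRM i j k l) hs0.le).trans hsM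

lemma two_smul_wedge_vecMulVec (v w : Fin n → ℝ) :
    (2 : ℝ) • wedge (vecMulVec v v) (vecMulVec w w) =
      (ipL (vwedge v w)).smulRight (vwedge v w) := by
  refine End_ext fun i j k l => ?_
  rw [Rcoord_smul, Rcoord_wedge, Rcoord_eq]
  have h : (((ipL (vwedge v w)).smulRight (vwedge v w) (bvec i j) : so n) : Mat n) k l =
      (vwedge v w : Mat n) i j * (vwedge v w : Mat n) k l := by
    rw [← ip_bvec (vwedge v w) i j]
    rfl
  rw [h]
  simp only [vwedge, vecMulVec_apply, Matrix.of_apply]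
  ring

lemma wedge_vecMulVec_mem_recCone (hclosed : isClosedSet C) (hconv : Convex ℝ C)
    (hrank1 : ∀ R : Module.End ℝ (so n), isCurvOp R →
      (∃ X : so n, X ≠ 0 ∧ R = (ipL X).smulRight X) → R ∈ C) (v w : Fin n → ℝ) :
    wedge (vecMulVec v v) (vecMulVec w w) ∈ recCone C := by
  have hsymm (u : Fin n → ℝ) : (vecMulVec u u)ᵀ = vecMulVec u u := transpose_vecMulVec u u
  by_cases h0 : vwedge v w = 0
  · have h1 := two_smul_wedge_vecMulVec v w
    rw [h0] at h1
    have h2 : wedge (vecMulVec v v) (vecMulVec w w) = 0 := by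
      have h3 : (2 : ℝ) • wedge (vecMulVec v v) (vecMulVec w w) = 0 := by
        rw [h1]
        ext
        simp
      simpa using h3
    rw [h2]
    exact zero_mem_recCone
  · have hmem : ∀ t : ℝ, 0 < t → t • wedge (vecMulVec v v) (vecMulVec w w) ∈ C := by
      intro t ht
      have hr : √(t / 2) ≠ 0 := (Real.sqrt_pos.2 (by positivity)).ne'
      refine hrank1 _ (isCurvOp_smul t (isCurvOp_wedge (hsymm v) (hsymm w)))
        ⟨√(t / 2) • vwedge v w, smul_ne_zero hr h0, ?_⟩
      have h1 : (ipL (√(t / 2) • vwedge v w)).smulRight (√(t / 2) • vwedge v w) =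
          (t / 2) • (ipL (vwedge v w)).smulRight (vwedge v w) := by
        ext1 Y
        simp only [LinearMap.smulRight_apply, LinearMap.smul_apply]
        rw [show ipL (√(t / 2) • vwedge v w) Y = √(t / 2) * ipL (vwedge v w) Y by
          simp only [ipL, LinearMap.coe_mk, AddHom.coe_mk, ip_eq_sum, Submodule.coe_smul,
            Matrix.smul_apply, smul_eq_mul, Finset.mul_sum]
          exact Finset.sum_congr rfl fun _ _ => Finset.sum_congr rfl fun _ _ => by ring,
          smul_smul, smul_smul]
        congr 1
        rw [mul_right_comm, Real.mul_self_sqrt (by positivity)]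
      rw [h1, ← two_smul_wedge_vecMulVec, smul_smul]
      congr 1
      ring
    intro R hR t ht
    rcases ht.eq_or_lt with rfl | ht
    · simpa using hR
    · refine add_mem_of_forall_smul_mem hclosed hconv hR fun s hs => ?_
      rw [smul_smul]
      exact hmem _ (mul_pos hs ht)

end recCone

lemma exists_spectral_sum {P : Mat n} (hP : P.PosSemidef) :
    ∃ (d : Fin n → ℝ) (v : Fin n → Fin n → ℝ), (∀ i, 0 ≤ d i) ∧
      P = ∑ i, d i • vecMulVec (v i) (v i) ∧
      P * P = ∑ i, d i ^ 2 • vecMulVec (v i) (v i) ∧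
      (1 : Mat n) = ∑ i, vecMulVec (v i) (v i) := by
  set U : Mat n := (hP.1.eigenvectorUnitary : Mat n) with hU
  set d := hP.1.eigenvalues with hd
  have hUU : star U * U = 1 := Unitary.coe_star_mul_self hP.1.eigenvectorUnitary
  have hUU' : U * star U = 1 := Unitary.coe_mul_star_self hP.1.eigenvectorUnitary
  have hspec : P = U * diagonal d * star U := by
    have := hP.1.spectral_theorem
    rw [Unitary.conjStarAlgAut_apply] at this
    exact this
  have hsum (e : Fin n → ℝ) : U * diagonal e * star U =
      ∑ i, e i • vecMulVec (fun j => U j i) (fun j => U j i) := by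
    ext j k
    rw [Matrix.mul_apply]
    simp only [Matrix.mul_diagonal, Matrix.star_apply, star_trivial,
      Matrix.sum_apply, Matrix.smul_apply, vecMulVec_apply, smul_eq_mul]
    exact Finset.sum_congr rfl fun i _ => by ring
  refine ⟨d, fun i j => U j i, fun i => hP.eigenvalues_nonneg i, hspec.trans (hsum d), ?_, ?_⟩
  · rw [← hsum (fun i => d i ^ 2)]
    conv_lhs => rw [hspec]
    rw [show U * diagonal d * star U * (U * diagonal d * star U) =
      U * (diagonal d * (star U * U) * diagonal d) * star U by simp only [Matrix.mul_assoc], hUU,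
      Matrix.mul_one, Matrix.diagonal_mul_diagonal]
    simp only [sq]
  · have h := hsum fun _ => 1
    simp only [one_smul, Matrix.diagonal_one, Matrix.mul_one, hUU'] at h
    exact h

lemma wedge_mem_recCone {C : Set (Module.End ℝ (so n))} (hclosed : isClosedSet C)
    (hconv : Convex ℝ C) (hrank1 : ∀ R : Module.End ℝ (so n), isCurvOp R →
      (∃ X : so n, X ≠ 0 ∧ R = (ipL X).smulRight X) → R ∈ C) {A B : Mat n}
    (hA : A.PosSemidef) (hB : B.PosSemidef) : wedge A B ∈ recCone C := by
  obtain ⟨d, v, hd, hAv, -, -⟩ := exists_spectral_sum hA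
  obtain ⟨e, w, he, hBw, -, -⟩ := exists_spectral_sum hB
  rw [hAv, hBw, wedge_sum_left]
  refine sum_mem_recCone _ fun i _ => ?_
  rw [wedge_sum_right]
  refine sum_mem_recCone _ fun j _ => ?_
  rw [wedge_smul_left, wedge_smul_right]
  exact smul_mem_recCone (smul_mem_recCone
    (wedge_vecMulVec_mem_recCone hclosed hconv hrank1 _ _) (he j)) (hd i)

/-- The symmetric matrix `(E_{ij} + E_{ji}) / 2`. -/
def symUnit (i j : Fin n) : Mat n :=
  Matrix.of fun x y => (1 / 2) * ((if x = i then 1 else 0) * (if y = j then 1 else 0)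
    + (if x = j then 1 else 0) * (if y = i then 1 else 0))

lemma transpose_symUnit (i j : Fin n) : (symUnit i j)ᵀ = symUnit i j := by
  ext x y
  simp only [symUnit, Matrix.transpose_apply, Matrix.of_apply]
  ring

lemma dotProduct_symUnit_mulVec (i j : Fin n) (x : Fin n → ℝ) :
    x ⬝ᵥ symUnit i j *ᵥ x = x i * x j := by
  simp only [dotProduct, Matrix.mulVec, symUnit, Matrix.of_apply, mul_add, add_mul, Finset.mul_sum,
    Finset.sum_add_distrib]
  simp only [mul_ite, ite_mul, mul_one, mul_zero, zero_mul, Finset.sum_ite_eq',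
    Finset.mem_univ, if_true]
  simp
  ring

lemma posSemidef_one_add_smul_symUnit (i j : Fin n) {s : ℝ} (hs : |s| ≤ 1) :
    ((1 : Mat n) + s • symUnit i j).PosSemidef := by
  refine Matrix.PosSemidef.of_dotProduct_mulVec_nonneg ?_ fun x => ?_
  · rw [Matrix.IsHermitian, Matrix.conjTranspose_eq_transpose_of_trivial, Matrix.transpose_add,
      Matrix.transpose_smul, transpose_symUnit, Matrix.transpose_one]
  · rw [star_trivial, Matrix.add_mulVec, Matrix.smul_mulVec, Matrix.one_mulVec, dotProduct_add,
      dotProduct_smul, dotProduct_symUnit_mulVec, smul_eq_mul]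
    have hs' := abs_le.1 hs
    have h (k : Fin n) : x k ^ 2 ≤ x ⬝ᵥ x := by
      rw [sq]
      exact Finset.single_le_sum (f := fun k => x k * x k) (fun _ _ => mul_self_nonneg _)
        (Finset.mem_univ k)
    have h1 : |s * (x i * x j)| ≤ x ⬝ᵥ x := by
      rw [abs_mul]
      have h2 : |x i * x j| ≤ x ⬝ᵥ x := by
        rw [abs_le]
        constructor <;> nlinarith [h i, h j, sq_nonneg (x i + x j), sq_nonneg (x i - x j)]
      nlinarith [abs_nonneg (x i * x j), abs_nonneg s]
    linarith [(abs_le.1 h1).1]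

lemma sum_mul_symUnit (f : Fin n → Fin n → Fin n → Fin n → ℝ) (x y z w : Fin n) :
    ∑ i, ∑ j, ∑ k, ∑ l, f i j k l * (symUnit i j x y * symUnit k l z w) =
      (1 / 4) * (f x y z w + f y x z w + f x y w z + f y x w z) := by
  simp only [symUnit, Matrix.of_apply, mul_add, add_mul, Finset.sum_add_distrib]
  simp only [mul_ite, ite_mul, mul_one, mul_zero, zero_mul, Finset.sum_ite_eq,
    Finset.mem_univ, if_true]
  simp
  ring

lemma eq_sum_wedge_symUnit {Z : Module.End ℝ (so n)} (hZ : isCurvOp Z) :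
    Z = ∑ i, ∑ j, ∑ k, ∑ l,
      ((2 / 3) * Rcoord Z i k j l) • wedge (symUnit i j) (symUnit k l) := by
  obtain ⟨hs, hb⟩ := isCurvOp_iff.1 hZ
  refine End_ext fun p q r s => ?_
  have h (x y z w : Fin n) := sum_mul_symUnit (fun i j k l => (1 / 3) * Rcoord Z i k j l) x y z w
  have hexp : Rcoord (∑ i, ∑ j, ∑ k, ∑ l,
      ((2 / 3) * Rcoord Z i k j l) • wedge (symUnit i j) (symUnit k l)) p q r s =
      ∑ i, ∑ j, ∑ k, ∑ l, (1 / 3) * Rcoord Z i k j l * (symUnit i j r p * symUnit k l s q)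
      - ∑ i, ∑ j, ∑ k, ∑ l, (1 / 3) * Rcoord Z i k j l * (symUnit i j r q * symUnit k l s p)
      + ∑ i, ∑ j, ∑ k, ∑ l, (1 / 3) * Rcoord Z i k j l * (symUnit i j s q * symUnit k l r p)
      - ∑ i, ∑ j, ∑ k, ∑ l, (1 / 3) * Rcoord Z i k j l * (symUnit i j s p * symUnit k l r q) := by
    simp only [Rcoord_sum, Rcoord_smul, Rcoord_wedge, ← Finset.sum_sub_distrib,
      ← Finset.sum_add_distrib]
    refine Finset.sum_congr rfl fun i _ => Finset.sum_congr rfl fun j _ =>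
      Finset.sum_congr rfl fun k _ => Finset.sum_congr rfl fun l _ => ?_
    ring
  rw [hexp, h, h, h, h]
  have l1 := Rcoord_swap_left Z
  have l2 := Rcoord_swap_right Z
  have e1 := hb p q r s
  simp only [l1 p q, l1 p r, l1 p s, l1 q r, l1 q s, l1 r s, fun i j => l2 i j p q,
    fun i j => l2 i j p r, fun i j => l2 i j p s, fun i j => l2 i j q r, fun i j => l2 i j q s,
    fun i j => l2 i j r s, hs r s p q, hs q s p r, hs q r p s] at e1 ⊢
  linarith

lemma exists_smul_wedge_one_add_mem_recCone (hn : 0 < n) {C : Set (Module.End ℝ (so n))}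
    (hclosed : isClosedSet C) (hconv : Convex ℝ C)
    (hrank1 : ∀ R : Module.End ℝ (so n), isCurvOp R →
      (∃ X : so n, X ≠ 0 ∧ R = (ipL X).smulRight X) → R ∈ C) {ε : ℝ} (hε : 0 < ε) :
    ∃ δ > 0, ∀ Z : Module.End ℝ (so n), isCurvOp Z → (∀ i j k l, |Rcoord Z i j k l| ≤ δ) →
      ε • wedge (1 : Mat n) 1 + Z ∈ recCone C := by
  have hn0 : (0 : ℝ) < n := by exact_mod_cast hn
  have hK {A B : Mat n} (hA : A.PosSemidef) (hB : B.PosSemidef) : wedge A B ∈ recCone C :=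
    wedge_mem_recCone hclosed hconv hrank1 hA hB
  have hpm (s : ℝ) (hs : |s| = 1) (i j k l : Fin n) :
      wedge (1 : Mat n) 1 + s • wedge (symUnit i j) (symUnit k l) ∈ recCone C := by
    have h1 := posSemidef_one_add_smul_symUnit i j hs.le
    have h2 := posSemidef_one_add_smul_symUnit i j (s := -s) (by rw [abs_neg, hs])
    have h3 := posSemidef_one_add_smul_symUnit k l (s := 1) (by simp)
    have h4 := posSemidef_one_add_smul_symUnit k l (s := -1) (by simp)
    convert smul_mem_recCone (add_mem_recCone (hK h1 h3) (hK h2 h4)) (s := 1 / 2) (by norm_num)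
      using 1
    simp only [wedge_add_left, wedge_add_right, wedge_smul_left, wedge_smul_right]
    module
  have hbd (c η : ℝ) (hc : |c| ≤ η) (i j k l : Fin n) :
      η • wedge (1 : Mat n) 1 + c • wedge (symUnit i j) (symUnit k l) ∈ recCone C := by
    have h0 : wedge (1 : Mat n) 1 ∈ recCone C := hK PosSemidef.one PosSemidef.one
    obtain ⟨s, hs, hcs⟩ : ∃ s : ℝ, |s| = 1 ∧ c = |c| * s := by
      rcases le_total 0 c with h | h
      · exact ⟨1, by simp, by rw [abs_of_nonneg h]; ring⟩
      · exact ⟨-1, by simp, by rw [abs_of_nonpos h]; ring⟩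
    convert add_mem_recCone (smul_mem_recCone (hpm s hs i j k l) (abs_nonneg c))
      (smul_mem_recCone h0 (sub_nonneg.2 hc)) using 1
    conv_lhs => rw [hcs]
    module
  refine ⟨ε / (n : ℝ) ^ 4, by positivity, fun Z hZ hZδ => ?_⟩
  have hsplit : ε • wedge (1 : Mat n) 1 =
      ∑ _i : Fin n, ∑ _j : Fin n, ∑ _k : Fin n, ∑ _l : Fin n,
        (ε / (n : ℝ) ^ 4) • wedge (1 : Mat n) 1 := by
    simp only [Finset.sum_const, Finset.card_univ, Fintype.card_fin, ← Nat.cast_smul_eq_nsmul ℝ,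
      smul_smul]
    congr 1
    field_simp
  rw [eq_sum_wedge_symUnit hZ, hsplit]
  simp only [← Finset.sum_add_distrib]
  refine sum_mem_recCone _ fun i _ => sum_mem_recCone _ fun j _ => sum_mem_recCone _ fun k _ =>
    sum_mem_recCone _ fun l _ => hbd _ _ ?_ _ _ _ _
  rw [abs_mul, abs_of_pos (by norm_num : (0 : ℝ) < 2 / 3)]
  linarith [hZδ i k j l, abs_nonneg (Rcoord Z i k j l)]

/-! ### Lower bound for the correction term -/

lemma param_bounds (hn : 3 ≤ n) {b : ℝ} (hb : b ∈ Set.Ioc 0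
    ((√(2 * (n : ℝ) * ((n : ℝ) - 2) + 4) - 2) / ((n : ℝ) * ((n : ℝ) - 2)))) :
    b ≤ 1 / 2 ∧ 0 ≤ 2 - 4 * b - n * (n - 2) * b ^ 2 := by
  have hn3 : (3 : ℝ) ≤ n := by exact_mod_cast hn
  obtain ⟨hb0, hb1⟩ := hb
  set m : ℝ := n * (n - 2) with hm
  have hm0 : 0 < m := by rw [hm]; nlinarith
  rw [le_div_iff₀ hm0] at hb1
  have h1 : b * m + 2 ≤ √(2 * (n : ℝ) * ((n : ℝ) - 2) + 4) := by linarith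
  have h2 : (b * m + 2) ^ 2 ≤ 2 * m + 4 := by
    have := (Real.le_sqrt' (by positivity)).1 h1
    rwa [show 2 * (n : ℝ) * ((n : ℝ) - 2) + 4 = 2 * m + 4 by rw [hm]; ring] at this
  have h3 : 0 ≤ m * (2 - 4 * b - m * b ^ 2) := by linarith
  have h4 : 0 ≤ 2 - 4 * b - m * b ^ 2 := nonneg_of_mul_nonneg_right h3 hm0
  refine ⟨?_, h4⟩
  have : 0 ≤ m * b ^ 2 := by positivity
  linarith

lemma Dab_sub_mem_recCone (hn : 3 ≤ n) {C : Set (Module.End ℝ (so n))}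
    (hclosed : isClosedSet C) (hconv : Convex ℝ C)
    (hrank1 : ∀ R : Module.End ℝ (so n), isCurvOp R →
      (∃ X : so n, X ≠ 0 ∧ R = (ipL X).smulRight X) → R ∈ C) {a b : ℝ} (hb0 : 0 < b)
    (hb2 : 0 ≤ 2 - 4 * b - n * (n - 2) * b ^ 2) (hab : b ^ 2 ≤ a)
    {R : Module.End ℝ (so n)} (hRic : (RicM R).PosSemidef) :
    Dab a b R - (b ^ 2 * lamb R ^ 2) • wedge (1 : Mat n) 1 ∈ recCone C := by
  have hn3 : (3 : ℝ) ≤ n := by exact_mod_cast hn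
  have ha : 0 ≤ a := (sq_nonneg b).trans hab
  obtain ⟨d, v, hd, hP, hPP, h1⟩ := exists_spectral_sum hRic
  have hP0 : Ric0 R * Ric0 R = ∑ i, (d i - lamb R) ^ 2 • vecMulVec (v i) (v i) := by
    rw [Ric0_mul_self, hPP]
    conv_lhs => rw [hP, h1]
    rw [Finset.smul_sum, Finset.smul_sum, ← Finset.sum_sub_distrib, ← Finset.sum_add_distrib]
    exact Finset.sum_congr rfl fun i _ => by module
  have hc : 0 ≤ Matrix.trace (Ric0 R * Ric0 R) * (b ^ 2 * (2 - 4 * b - n * (n - 2) * b ^ 2))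
      / (n + 2 * n * (n - 1) * a) := by
    have htr : 0 ≤ Matrix.trace (Ric0 R * Ric0 R) := by
      rw [hP0, Matrix.trace_sum]
      refine Finset.sum_nonneg fun i _ => ?_
      rw [Matrix.trace_smul, Matrix.trace_vecMulVec, smul_eq_mul]
      exact mul_nonneg (sq_nonneg _) (Finset.sum_nonneg fun j _ => mul_self_nonneg _)
    have hden : 0 ≤ (n : ℝ) + 2 * n * (n - 1) * a := by
      have : 0 ≤ (n : ℝ) - 1 := by linarith
      positivity
    positivity
  set c := Matrix.trace (Ric0 R * Ric0 R) * (b ^ 2 * (2 - 4 * b - n * (n - 2) * b ^ 2))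
      / (n + 2 * n * (n - 1) * a) with hcdef
  set lam := lamb R with hlam
  have hsum (e f : Fin n → ℝ) : wedge (∑ i, e i • vecMulVec (v i) (v i))
      (∑ j, f j • vecMulVec (v j) (v j)) =
      ∑ i, ∑ j, (e i * f j) • wedge (vecMulVec (v i) (v i)) (vecMulVec (v j) (v j)) := by
    rw [wedge_sum_left]
    refine Finset.sum_congr rfl fun i _ => ?_
    rw [wedge_sum_right]
    refine Finset.sum_congr rfl fun j _ => ?_
    rw [wedge_smul_left, wedge_smul_right, smul_smul]
  have h1' : (1 : Mat n) = ∑ i, (1 : ℝ) • vecMulVec (v i) (v i) := by simpa using h1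
  have e1 : wedge (RicM R) (RicM R) = ∑ i, ∑ j, (d i * d j) •
      wedge (vecMulVec (v i) (v i)) (vecMulVec (v j) (v j)) := by rw [← hsum, ← hP]
  have e2 : wedge (1 : Mat n) 1 = ∑ i, ∑ j, (1 * 1 : ℝ) •
      wedge (vecMulVec (v i) (v i)) (vecMulVec (v j) (v j)) := by
    rw [← hsum (fun _ => 1) (fun _ => 1), ← h1']
  have e3 : wedge (Ric0 R * Ric0 R) 1 = ∑ i, ∑ j, ((d i - lam) ^ 2 * 1) •
      wedge (vecMulVec (v i) (v i)) (vecMulVec (v j) (v j)) := by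
    rw [← hsum (fun i => (d i - lam) ^ 2) (fun _ => 1), ← h1', hP0]
  have e4 : wedge (Ric0 R * Ric0 R) 1 = ∑ i, ∑ j, (1 * (d j - lam) ^ 2) •
      wedge (vecMulVec (v i) (v i)) (vecMulVec (v j) (v j)) := by
    rw [← hsum (fun _ => 1) (fun i => (d i - lam) ^ 2), ← h1', hP0, wedge_comm]
  have hD : Dab a b R - (b ^ 2 * lam ^ 2) • wedge (1 : Mat n) 1 =
      ∑ i, ∑ j, (2 * a * (d i * d j) + b ^ 2 * ((d i - lam) ^ 2 + (d j - lam) ^ 2) + c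
        - b ^ 2 * lam ^ 2) • wedge (vecMulVec (v i) (v i)) (vecMulVec (v j) (v j)) := by
    have hsplit : Dab a b R - (b ^ 2 * lam ^ 2) • wedge (1 : Mat n) 1 =
        (2 * a) • wedge (RicM R) (RicM R) + (b ^ 2) • wedge (Ric0 R * Ric0 R) 1
          + (b ^ 2) • wedge (Ric0 R * Ric0 R) 1
          + (c - b ^ 2 * lam ^ 2) • wedge (1 : Mat n) 1 := by
      rw [Dab, ← hcdef]
      module
    rw [hsplit]
    conv_lhs =>
      enter [1, 2]
      rw [e4]
    rw [e1, e2, e3]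
    simp only [Finset.smul_sum, ← Finset.sum_add_distrib]
    exact Finset.sum_congr rfl fun i _ => Finset.sum_congr rfl fun j _ => by module
  rw [hD]
  refine sum_mem_recCone _ fun i _ => sum_mem_recCone _ fun j _ =>
    smul_mem_recCone (wedge_vecMulVec_mem_recCone hclosed hconv hrank1 _ _) ?_
  nlinarith [mul_nonneg (sub_nonneg.2 hab) (mul_nonneg (hd i) (hd j)),
    mul_nonneg (sq_nonneg b) (sq_nonneg (d i + d j - lam))]

lemma isCurvOp_lab (hn : 3 ≤ n) (a b : ℝ) {R : Module.End ℝ (so n)} (hR : isCurvOp R) :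
    isCurvOp (lab a b R) := by
  rw [lab_eq hn]
  refine isCurvOp_add hR (isCurvOp_wedge ?_ Matrix.transpose_one)
  rw [Matrix.transpose_add, Matrix.transpose_smul, Matrix.transpose_smul, transpose_RicM hR,
    Matrix.transpose_one]

lemma lamb_add (R S : Module.End ℝ (so n)) : lamb (R + S) = lamb R + lamb S := by
  simp only [lamb, RicM_add, Matrix.trace_add, add_div]

lemma lamb_smul (t : ℝ) (R : Module.End ℝ (so n)) : lamb (t • R) = t * lamb R := by
  simp only [lamb, RicM_smul, Matrix.trace_smul, smul_eq_mul, mul_div_assoc]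

lemma lab_add (hn : 3 ≤ n) (a b : ℝ) (R S : Module.End ℝ (so n)) :
    lab a b (R + S) = lab a b R + lab a b S := by
  simp only [lab_eq hn, lamb_add, RicM_add, wedge_add_left, wedge_smul_left]
  module

lemma lab_smul (hn : 3 ≤ n) (a b t : ℝ) (R : Module.End ℝ (so n)) :
    lab a b (t • R) = t • lab a b R := by
  simp only [lab_eq hn, lamb_smul, RicM_smul, wedge_add_left, wedge_smul_left]
  module

lemma lab_sub (hn : 3 ≤ n) (a b : ℝ) (R S : Module.End ℝ (so n)) :
    lab a b (R - S) = lab a b R - lab a b S := by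
  rw [show R - S = R + (-1 : ℝ) • S by module, lab_add hn, lab_smul hn]
  module

lemma lab_lab_inverse (hn : 3 ≤ n) {a b : ℝ} (ha : 1 + 2 * ((n : ℝ) - 1) * a ≠ 0)
    (hb : 1 + ((n : ℝ) - 2) * b ≠ 0) {R : Module.End ℝ (so n)} (hR : isCurvOp R) :
    lab a b (lab (-a / (1 + 2 * ((n : ℝ) - 1) * a)) (-b / (1 + ((n : ℝ) - 2) * b)) R) = R := by
  have hn3 : (3 : ℝ) ≤ n := by exact_mod_cast hn
  have hn0 : (n : ℝ) ≠ 0 := by linarith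
  have hT : (1 : Mat n)ᵀ = 1 := Matrix.transpose_one
  have hP := transpose_RicM hR
  have htr1 : Matrix.trace (1 : Mat n) = n := by simp
  have htrP : Matrix.trace (RicM R) = n * lamb R := by rw [lamb]; field_simp
  set a' := -a / (1 + 2 * ((n : ℝ) - 1) * a) with ha'
  set b' := -b / (1 + ((n : ℝ) - 2) * b) with hb'
  have hRic : RicM (lab a' b' R) = (1 + (n - 2) * b') • RicM R
      + (2 * (a' - b') * lamb R * (n - 1) + b' * n * lamb R) • (1 : Mat n) := by
    simp only [lab_eq hn, RicM_add, wedge_add_left, wedge_smul_left, RicM_smul,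
      RicM_wedge hT hT, RicM_wedge hP hT, htr1, htrP, Matrix.mul_one, Matrix.one_mul]
    module
  have hlam : lamb (lab a' b' R) = (1 + 2 * (n - 1) * a') * lamb R := by
    rw [lamb, hRic, Matrix.trace_add, Matrix.trace_smul, Matrix.trace_smul, htrP, htr1]
    simp only [smul_eq_mul]
    field_simp
    ring
  have ha2 : a + a' + 2 * (n - 1) * a * a' = 0 := by
    linear_combination div_mul_cancel₀ (-a) ha
  have hb2 : b + b' + (n - 2) * b * b' = 0 := by
    linear_combination div_mul_cancel₀ (-b) hb
  rw [lab_eq hn a b, hlam, hRic, lab_eq hn a' b']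
  simp only [wedge_add_left, wedge_smul_left]
  match_scalars
  · ring
  · linear_combination 2 * lamb R * ha2 - 2 * lamb R * hb2
  · linear_combination 2 * hb2

/-! ### Tangent cones -/

lemma add_mem_tangCone {C : Set (Module.End ℝ (so n))} {R X D : Module.End ℝ (so n)}
    (hR : R ∈ C) (hX : X ∈ tangCone C R) (hD : D ∈ recCone C) : X + D ∈ tangCone C R := by
  rw [mem_tangCone_iff] at hX ⊢
  intro δ hδ
  obtain ⟨S, hS, t, ht, h⟩ := hX δ hδ
  rcases ht.eq_or_lt with rfl | ht
  · refine ⟨R + (1 : ℝ) • D, hD R hR 1 zero_le_one, 1, zero_le_one, ?_⟩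
    rwa [show X + D - (1 : ℝ) • (R + (1 : ℝ) • D - R) = X - (0 : ℝ) • (S - R) by module]
  · refine ⟨S + t⁻¹ • D, hD S hS _ (inv_nonneg.2 ht.le), t, ht.le, ?_⟩
    have : X + D - t • (S + t⁻¹ • D - R) = X - t • (S - R) := by
      rw [show t • (S + t⁻¹ • D - R) = t • (S - R) + (t * t⁻¹) • D by module,
        mul_inv_cancel₀ ht.ne']
      module
    rwa [this]

lemma lab_mem_tangCone (hn : 3 ≤ n) (a b : ℝ) {C : Set (Module.End ℝ (so n))}
    {R X : Module.End ℝ (so n)} (hX : X ∈ tangCone C R) :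
    lab a b X ∈ tangCone (lab a b '' C) (lab a b R) := by
  rw [mem_tangCone_iff] at hX ⊢
  intro δ hδ
  obtain ⟨M, hM, hlab⟩ := exists_abs_Rcoord_lab_le hn a b
  obtain ⟨S, hS, t, ht, h⟩ := hX (δ / M) (by positivity)
  refine ⟨lab a b S, ⟨S, hS, rfl⟩, t, ht, fun i j k l => ?_⟩
  rw [← lab_sub hn, ← lab_smul hn, ← lab_sub hn]
  refine (hlab _ _ (by positivity) h i j k l).trans_eq ?_
  field_simp

/-- Proposition: the image `ℓ_{a,b}(C)` of a suitable ODE-invariant set `C` is again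
invariant under the ODE `dR/dt = R² + R^#`, and transverse to the boundary at nonzero
boundary points. -/
theorem stmt_12 {n : ℕ} (hn : 3 ≤ n) (C : Set (Module.End ℝ (so n)))
    (hsub : ∀ R ∈ C, isCurvOp R)
    (hclosed : isClosedSet C) (hconv : Convex ℝ C)
    (hOinv : ∀ g : Mat n, g * gᵀ = 1 → ∀ R ∈ C, onAct g R ∈ C)
    (hscal : ∀ R ∈ C, R ≠ 0 → 0 < Matrix.trace (RicM R))
    (hricci : ∀ R ∈ C, (RicM R).PosSemidef)
    (hrank1 : ∀ R : Module.End ℝ (so n), isCurvOp R →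
      (∃ X : so n, X ≠ 0 ∧ R = (ipL X).smulRight X) → R ∈ C)
    (hode : ∀ R ∈ C, Qode R ∈ tangCone C R)
    (b : ℝ)
    (hb : b ∈ Set.Ioc 0
      ((Real.sqrt (2 * (n : ℝ) * ((n : ℝ) - 2) + 4) - 2) / ((n : ℝ) * ((n : ℝ) - 2))))
    (a : ℝ) (ha : 2 * a = 2 * b + ((n : ℝ) - 2) * b ^ 2) :
    (∀ S ∈ lab a b '' C, Qode S ∈ tangCone (lab a b '' C) S) ∧
      ∀ S ∈ lab a b '' C, S ≠ 0 → Qode S ∈ interiorCurv (tangCone (lab a b '' C) S) := by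
  have hn3 : (3 : ℝ) ≤ n := by exact_mod_cast hn
  have hb0 : 0 < b := hb.1
  obtain ⟨hb1, hb2⟩ := param_bounds hn hb
  have hba : b ≤ a := by nlinarith [mul_nonneg (by linarith : (0 : ℝ) ≤ n - 2) (sq_nonneg b)]
  have hab : b ^ 2 ≤ a := by nlinarith
  have ha1 : 1 + 2 * ((n : ℝ) - 1) * a ≠ 0 := by
    have : 0 ≤ ((n : ℝ) - 1) * a := mul_nonneg (by linarith) (by linarith)
    linarith
  have hb3 : 1 + ((n : ℝ) - 2) * b ≠ 0 := by
    have : 0 ≤ ((n : ℝ) - 2) * b := mul_nonneg (by linarith) hb0.le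
    linarith
  have hDsub (R) (hR : R ∈ C) :
      Dab a b R - (b ^ 2 * lamb R ^ 2) • wedge (1 : Mat n) 1 ∈ recCone C :=
    Dab_sub_mem_recCone hn hclosed hconv hrank1 hb0 hb2 hab (hricci R hR)
  have hinv : ∀ S ∈ lab a b '' C, Qode S ∈ tangCone (lab a b '' C) S := by
    rintro _ ⟨R, hR, rfl⟩
    rw [Qode_lab hn ha ha1 (hsub R hR)]
    refine lab_mem_tangCone hn a b (add_mem_tangCone hR (hode R hR) ?_)
    have h1 : wedge (1 : Mat n) 1 ∈ recCone C :=
      wedge_mem_recCone hclosed hconv hrank1 PosSemidef.one PosSemidef.one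
    convert add_mem_recCone (hDsub R hR)
      (smul_mem_recCone h1 (by positivity : 0 ≤ b ^ 2 * lamb R ^ 2)) using 1
    module
  refine ⟨hinv, fun S hS hS0 => ?_⟩
  have hcurv : ∀ T ∈ lab a b '' C, isCurvOp T := by
    rintro _ ⟨R, hR, rfl⟩
    exact isCurvOp_lab hn a b (hsub R hR)
  have hQS : isCurvOp (Qode S) := isCurvOp_of_mem_tangCone hcurv (hcurv S hS) (hinv S hS)
  refine ⟨hQS, ?_⟩
  obtain ⟨R, hR, rfl⟩ := hS
  have hR0 : R ≠ 0 := by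
    rintro rfl
    apply hS0
    simpa using lab_smul hn a b 0 0
  have hlam : 0 < lamb R := div_pos (hscal R hR hR0) (by linarith)
  obtain ⟨δ, hδ, hint⟩ := exists_smul_wedge_one_add_mem_recCone (by omega) hclosed hconv hrank1
    (by positivity : 0 < b ^ 2 * lamb R ^ 2)
  set a' := -a / (1 + 2 * ((n : ℝ) - 1) * a) with ha'
  set b' := -b / (1 + ((n : ℝ) - 2) * b) with hb'
  obtain ⟨M, hM, hlab⟩ := exists_abs_Rcoord_lab_le hn a' b'
  refine ⟨δ / (2 * M), by positivity, fun Y hY hYδ => ?_⟩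
  set W := Y - Qode (lab a b R) with hW
  have hWc : isCurvOp W := isCurvOp_sub hY hQS
  have hZ := hint (lab a' b' W) (isCurvOp_lab hn a' b' hWc) fun i j k l => by
    refine (hlab W (2 * endNorm W) (mul_nonneg zero_le_two (Real.sqrt_nonneg _))
      (abs_Rcoord_le_endNorm W) i j k l).trans ?_
    rw [lt_div_iff₀ (by positivity)] at hYδ
    linarith
  have hYeq : Y = lab a b (Qode R + ((Dab a b R - (b ^ 2 * lamb R ^ 2) • wedge (1 : Mat n) 1)
      + ((b ^ 2 * lamb R ^ 2) • wedge (1 : Mat n) 1 + lab a' b' W))) := by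
    rw [show Qode R + ((Dab a b R - (b ^ 2 * lamb R ^ 2) • wedge (1 : Mat n) 1)
      + ((b ^ 2 * lamb R ^ 2) • wedge (1 : Mat n) 1 + lab a' b' W)) =
      (Qode R + Dab a b R) + lab a' b' W by module, lab_add hn, ← Qode_lab hn ha ha1 (hsub R hR),
      ha', hb', lab_lab_inverse hn ha1 hb3 hWc, hW]
    module
  rw [hYeq]
  exact lab_mem_tangCone hn a b
    (add_mem_tangCone hR (hode R hR) (add_mem_recCone (hDsub R hR) hZ))

end BW
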